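/- arXiv:1601.00558 — 7 statements merged into one kernel-verified Lean document; each statement's English description precedes it below -/
import Mathlib

section
/- For every integer n = 2k+1 with k ≥ 2 and all positive integers p, q, the p×q rectangle admits a signed tiling by T_n if and only if n divides p or n divides q. -/
open scoped BigOperators Classical

/-- Translate a tile (a set of cells in `ℤ × ℤ`) by a vector `v`. -/
def tileTranslate (v : ℤ × ℤ) (T : Set (ℤ × ℤ)) : Set (ℤ × ℤ) := (fun c => v + c) '' T

/-- The ribbon L `n`-omino `T1 = {(0,j) : 0 ≤ j ≤ n-2} ∪ {(1,0)}`. -/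
def T1 (n : ℕ) : Set (ℤ × ℤ) :=
  {c | c.1 = 0 ∧ 0 ≤ c.2 ∧ c.2 ≤ (n : ℤ) - 2} ∪ {((1 : ℤ), (0 : ℤ))}

/-- The ribbon L `n`-omino `T2 = {(0,n-2)} ∪ {(1,j) : 0 ≤ j ≤ n-2}`. -/
def T2 (n : ℕ) : Set (ℤ × ℤ) :=
  {((0 : ℤ), (n : ℤ) - 2)} ∪ {c | c.1 = 1 ∧ 0 ≤ c.2 ∧ c.2 ≤ (n : ℤ) - 2}

/-- The ribbon L `n`-omino `T3 = {(i,0) : 0 ≤ i ≤ n-2} ∪ {(0,1)}`. -/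
def T3 (n : ℕ) : Set (ℤ × ℤ) :=
  {c | c.2 = 0 ∧ 0 ≤ c.1 ∧ c.1 ≤ (n : ℤ) - 2} ∪ {((0 : ℤ), (1 : ℤ))}

/-- The ribbon L `n`-omino `T4 = {(i,1) : 0 ≤ i ≤ n-2} ∪ {(n-2,0)}`. -/
def T4 (n : ℕ) : Set (ℤ × ℤ) :=
  {c | c.2 = 1 ∧ 0 ≤ c.1 ∧ c.1 ≤ (n : ℤ) - 2} ∪ {(((n : ℤ) - 2), (0 : ℤ))}

/-- The tile set `T_n` of the four ribbon L `n`-ominoes. -/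
def TileSet (n : ℕ) : Set (Set (ℤ × ℤ)) := {T1 n, T2 n, T3 n, T4 n}

/-- `w` is a signed tiling of the region `R` by the tile set `tiles`:
a finitely supported integer weight on placements `(T, v)`, supported on placements of
tiles from `tiles`, such that for each cell the weights of placements covering it sum to
`1` inside `R` and `0` outside. -/
def IsSignedTiling (tiles : Set (Set (ℤ × ℤ))) (R : Set (ℤ × ℤ))
    (w : Set (ℤ × ℤ) × (ℤ × ℤ) → ℤ) : Prop :=
  (Function.support w).Finite ∧
  (∀ p, w p ≠ 0 → p.1 ∈ tiles) ∧
  ∀ c : ℤ × ℤ,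
    (∑ᶠ p ∈ {p : Set (ℤ × ℤ) × (ℤ × ℤ) | c ∈ tileTranslate p.2 p.1}, w p) =
      if c ∈ R then 1 else 0

/-- `P` is a (regular) tiling of the region `R` by the tile set `tiles`: a finite
collection of placements of tiles from `tiles` whose translated copies are pairwise
disjoint and cover exactly `R`. -/
def IsTiling (tiles : Set (Set (ℤ × ℤ))) (R : Set (ℤ × ℤ))
    (P : Finset (Set (ℤ × ℤ) × (ℤ × ℤ))) : Prop :=
  (∀ p ∈ P, p.1 ∈ tiles) ∧
  (∀ p ∈ P, ∀ q ∈ P, p ≠ q → Disjoint (tileTranslate p.2 p.1) (tileTranslate q.2 q.1)) ∧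
  (⋃ p ∈ P, tileTranslate p.2 p.1) = R

/-- The `p × q` rectangle (height `p`, base `q`) with lower-left corner at the origin. -/
def Rect (p q : ℕ) : Set (ℤ × ℤ) :=
  {c | 0 ≤ c.1 ∧ c.1 ≤ (q : ℤ) - 1 ∧ 0 ≤ c.2 ∧ c.2 ≤ (p : ℤ) - 1}

open AddMonoidAlgebra
open scoped Pointwise

/-- The generating Laurent polynomial of a set of cells (junk value `0` on infinite sets). -/
noncomputable def cellPoly (R : Set (ℤ × ℤ)) : AddMonoidAlgebra ℤ (ℤ × ℤ) :=
  ∑ᶠ c ∈ R, single c 1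

/-- The first variable of the Laurent polynomial ring. -/
noncomputable def varX : AddMonoidAlgebra ℤ (ℤ × ℤ) := single (1, 0) 1

/-- The second variable of the Laurent polynomial ring. -/
noncomputable def varY : AddMonoidAlgebra ℤ (ℤ × ℤ) := single (0, 1) 1

lemma varX_pow_mul_varY_pow (i j : ℕ) :
    varX ^ i * varY ^ j = single ((i : ℤ), (j : ℤ)) 1 := by
  simp [varX, varY, single_pow, single_mul_single]

lemma coeff_cellPoly {R : Set (ℤ × ℤ)} (hR : R.Finite) (c : ℤ × ℤ) :
    (cellPoly R).coeff c = if c ∈ R then 1 else 0 := by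
  rw [cellPoly, finsum_mem_eq_finite_toFinset_sum _ hR, coeff_sum, Finset.sum_apply']
  simp [Finsupp.single_apply]

lemma cellPoly_image {ι : Type*} (f : ι → ℤ × ℤ) (s : Finset ι) (hf : Set.InjOn f s) :
    cellPoly (f '' s) = ∑ i ∈ s, single (f i) 1 := by
  rw [cellPoly, finsum_mem_image hf, finsum_mem_coe_finset]

lemma cellPoly_singleton (c : ℤ × ℤ) : cellPoly {c} = single c 1 := finsum_mem_singleton

lemma cellPoly_union {R S : Set (ℤ × ℤ)} (h : Disjoint R S) (hR : R.Finite) (hS : S.Finite) :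
    cellPoly (R ∪ S) = cellPoly R + cellPoly S := finsum_mem_union h hR hS

lemma cellPoly_tileTranslate (v : ℤ × ℤ) {T : Set (ℤ × ℤ)} (hT : T.Finite) :
    cellPoly (tileTranslate v T) = single v 1 * cellPoly T := by
  lift T to Finset (ℤ × ℤ) using hT
  rw [tileTranslate, cellPoly_image _ _ (add_right_injective v).injOn, cellPoly,
    finsum_mem_coe_finset, Finset.mul_sum]
  simp [single_mul_single]

lemma span_range_single_eq_top :
    Submodule.span ℤ (Set.range fun v : ℤ × ℤ => single v (1 : ℤ)) = ⊤ := by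
  refine eq_top_iff.2 fun x _ => ?_
  induction x using AddMonoidAlgebra.induction_linear with
  | zero => exact zero_mem _
  | add x y hx hy => exact add_mem (hx trivial) (hy trivial)
  | single m r =>
    have h : single m r = r • single m (1 : ℤ) := by simp [smul_single]
    rw [h]
    exact Submodule.smul_mem _ _ (Submodule.subset_span ⟨m, rfl⟩)

/-- The weights of a signed tiling are the coefficients expressing the polynomial of the region
through the polynomials of the placed tiles. -/
lemma cover_eq_coeff_linearCombination {tiles : Set (Set (ℤ × ℤ))} (ht : ∀ T ∈ tiles, T.Finite)
    (w : Set (ℤ × ℤ) × (ℤ × ℤ) →₀ ℤ) (hw : ∀ p, w p ≠ 0 → p.1 ∈ tiles) (c : ℤ × ℤ) :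
    (∑ᶠ p ∈ {p : Set (ℤ × ℤ) × (ℤ × ℤ) | c ∈ tileTranslate p.2 p.1}, w p) =
      (Finsupp.linearCombination ℤ (fun p : Set (ℤ × ℤ) × (ℤ × ℤ) =>
        cellPoly (tileTranslate p.2 p.1)) w).coeff c := by
  rw [finsum_mem_def, finsum_eq_sum_of_support_subset (s := w.support),
    Finsupp.linearCombination_apply, Finsupp.sum, coeff_sum, Finset.sum_apply']
  · refine Finset.sum_congr rfl fun p hp => ?_
    have hfin : (tileTranslate p.2 p.1).Finite :=
      (ht _ (hw p (Finsupp.mem_support_iff.1 hp))).image _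
    rw [coeff_smul_apply, coeff_cellPoly hfin, Set.indicator_apply]
    simp
  · intro p hp
    rw [Set.support_indicator] at hp
    simpa using hp.2

/-- A finite region has a signed tiling iff its polynomial lies in the ideal of the tiles. -/
theorem exists_isSignedTiling_iff_cellPoly_mem_span {tiles : Set (Set (ℤ × ℤ))}
    (ht : ∀ T ∈ tiles, T.Finite) {R : Set (ℤ × ℤ)} (hR : R.Finite) :
    (∃ w, IsSignedTiling tiles R w) ↔ cellPoly R ∈ Ideal.span (cellPoly '' tiles) := by
  set P : Set (ℤ × ℤ) × (ℤ × ℤ) → AddMonoidAlgebra ℤ (ℤ × ℤ) :=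
    fun p => cellPoly (tileTranslate p.2 p.1)
  have himage : P '' {p | p.1 ∈ tiles} =
      (Set.range fun v : ℤ × ℤ => single v (1 : ℤ)) • (cellPoly '' tiles) := by
    ext f
    simp only [Set.mem_image, Set.mem_ofPred_eq, smul_eq_mul]
    constructor
    · rintro ⟨p, hp, rfl⟩
      exact ⟨_, ⟨p.2, rfl⟩, _, ⟨p.1, hp, rfl⟩, (cellPoly_tileTranslate _ (ht _ hp)).symm⟩
    · rintro ⟨_, ⟨v, rfl⟩, _, ⟨T, hT, rfl⟩, rfl⟩
      exact ⟨(T, v), hT, cellPoly_tileTranslate _ (ht _ hT)⟩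
  have hmem : cellPoly R ∈ Ideal.span (cellPoly '' tiles) ↔
      cellPoly R ∈ Submodule.span ℤ (P '' {p | p.1 ∈ tiles}) := by
    rw [himage, Submodule.span_smul_of_span_eq_top span_range_single_eq_top,
      Submodule.restrictScalars_mem]
  rw [hmem, Finsupp.mem_span_image_iff_linearCombination]
  constructor
  · rintro ⟨w, hfin, hsupp, hcover⟩
    refine ⟨Finsupp.ofSupportFinite w hfin, ?_, ?_⟩
    · intro p hp
      exact hsupp p (Finsupp.mem_support_iff.1 hp)
    · ext c
      rw [← cover_eq_coeff_linearCombination ht _ hsupp, coeff_cellPoly hR]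
      exact hcover c
  · rintro ⟨w, hsupp, hw⟩
    have hsupp' : ∀ p, w p ≠ 0 → p.1 ∈ tiles :=
      fun p hp => hsupp (Finsupp.mem_support_iff.2 hp)
    refine ⟨w, w.hasFiniteSupport, hsupp', fun c => ?_⟩
    rw [cover_eq_coeff_linearCombination ht w hsupp', hw, coeff_cellPoly hR]

lemma vertical_eq_image (a : ℤ) (n : ℕ) (hn : 1 ≤ n) :
    {c : ℤ × ℤ | c.1 = a ∧ 0 ≤ c.2 ∧ c.2 ≤ (n : ℤ) - 2} =
      (fun j : ℕ => (a, (j : ℤ))) '' (Finset.range (n - 1)) := by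
  ext ⟨x, y⟩
  simp only [Set.mem_ofPred_eq, Set.mem_image, Finset.coe_range, Set.mem_Iio, Prod.mk.injEq]
  constructor
  · rintro ⟨rfl, h0, h1⟩
    exact ⟨y.toNat, by omega, rfl, by omega⟩
  · rintro ⟨j, hj, rfl, rfl⟩
    omega

lemma horizontal_eq_image (b : ℤ) (n : ℕ) (hn : 1 ≤ n) :
    {c : ℤ × ℤ | c.2 = b ∧ 0 ≤ c.1 ∧ c.1 ≤ (n : ℤ) - 2} =
      (fun i : ℕ => ((i : ℤ), b)) '' (Finset.range (n - 1)) := by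
  ext ⟨x, y⟩
  simp only [Set.mem_ofPred_eq, Set.mem_image, Finset.coe_range, Set.mem_Iio, Prod.mk.injEq]
  constructor
  · rintro ⟨rfl, h0, h1⟩
    exact ⟨x.toNat, by omega, by omega, rfl⟩
  · rintro ⟨j, hj, rfl, rfl⟩
    omega

lemma finite_vertical (a : ℤ) (n : ℕ) (hn : 1 ≤ n) :
    {c : ℤ × ℤ | c.1 = a ∧ 0 ≤ c.2 ∧ c.2 ≤ (n : ℤ) - 2}.Finite := by
  rw [vertical_eq_image a n hn]
  exact (Finset.finite_toSet _).image _

lemma finite_horizontal (b : ℤ) (n : ℕ) (hn : 1 ≤ n) :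
    {c : ℤ × ℤ | c.2 = b ∧ 0 ≤ c.1 ∧ c.1 ≤ (n : ℤ) - 2}.Finite := by
  rw [horizontal_eq_image b n hn]
  exact (Finset.finite_toSet _).image _

lemma cellPoly_vertical (a n : ℕ) (hn : 1 ≤ n) :
    cellPoly {c : ℤ × ℤ | c.1 = a ∧ 0 ≤ c.2 ∧ c.2 ≤ (n : ℤ) - 2} =
      varX ^ a * ∑ j ∈ Finset.range (n - 1), varY ^ j := by
  rw [vertical_eq_image _ n hn, cellPoly_image, Finset.mul_sum]
  · simp_rw [varX_pow_mul_varY_pow]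
  · intro i _ j _ h
    simpa using h

lemma cellPoly_horizontal (b n : ℕ) (hn : 1 ≤ n) :
    cellPoly {c : ℤ × ℤ | c.2 = b ∧ 0 ≤ c.1 ∧ c.1 ≤ (n : ℤ) - 2} =
      varY ^ b * ∑ i ∈ Finset.range (n - 1), varX ^ i := by
  rw [horizontal_eq_image _ n hn, cellPoly_image, Finset.mul_sum]
  · simp_rw [mul_comm (varY ^ b), varX_pow_mul_varY_pow]
  · intro i _ j _ h
    simpa using h

lemma cellPoly_T1 (n : ℕ) (hn : 1 ≤ n) :
    cellPoly (T1 n) = ∑ j ∈ Finset.range (n - 1), varY ^ j + varX := by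
  have h := cellPoly_vertical 0 n hn
  rw [Nat.cast_zero, pow_zero, one_mul] at h
  rw [T1, cellPoly_union (by simp) (finite_vertical _ n hn) (Set.finite_singleton _), h,
    cellPoly_singleton, varX]

lemma cellPoly_T2 (n : ℕ) (hn : 2 ≤ n) :
    cellPoly (T2 n) = varY ^ (n - 2) + varX * ∑ j ∈ Finset.range (n - 1), varY ^ j := by
  have h := cellPoly_vertical 1 n (by omega)
  rw [Nat.cast_one, pow_one] at h
  have hc : (0, (n : ℤ) - 2) = (((0 : ℕ) : ℤ), ((n - 2 : ℕ) : ℤ)) := by simp [hn]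
  rw [T2, cellPoly_union (by simp) (Set.finite_singleton _) (finite_vertical _ n (by omega)), h,
    cellPoly_singleton, hc, ← varX_pow_mul_varY_pow, pow_zero, one_mul]

lemma cellPoly_T3 (n : ℕ) (hn : 1 ≤ n) :
    cellPoly (T3 n) = ∑ i ∈ Finset.range (n - 1), varX ^ i + varY := by
  have h := cellPoly_horizontal 0 n hn
  rw [Nat.cast_zero, pow_zero, one_mul] at h
  rw [T3, cellPoly_union (by simp) (finite_horizontal _ n hn) (Set.finite_singleton _), h,
    cellPoly_singleton, varY]

lemma cellPoly_T4 (n : ℕ) (hn : 2 ≤ n) :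
    cellPoly (T4 n) = varY * ∑ i ∈ Finset.range (n - 1), varX ^ i + varX ^ (n - 2) := by
  have h := cellPoly_horizontal 1 n (by omega)
  rw [Nat.cast_one, pow_one] at h
  have hc : ((n : ℤ) - 2, 0) = (((n - 2 : ℕ) : ℤ), ((0 : ℕ) : ℤ)) := by simp [hn]
  rw [T4, cellPoly_union (by simp) (finite_horizontal _ n (by omega)) (Set.finite_singleton _), h,
    cellPoly_singleton, hc, ← varX_pow_mul_varY_pow, pow_zero, mul_one]

lemma Rect_eq_image (p q : ℕ) :
    Rect p q = (fun c : ℕ × ℕ => ((c.1 : ℤ), (c.2 : ℤ))) ''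
      (Finset.range q ×ˢ Finset.range p : Finset (ℕ × ℕ)) := by
  ext ⟨x, y⟩
  simp only [Rect, Set.mem_ofPred_eq, Set.mem_image, Finset.mem_coe, Finset.mem_product,
    Finset.mem_range, Prod.mk.injEq, Prod.exists]
  constructor
  · rintro ⟨h1, h2, h3, h4⟩
    exact ⟨x.toNat, y.toNat, by omega, by omega, by omega⟩
  · rintro ⟨i, j, hij, rfl, rfl⟩
    omega

lemma finite_Rect (p q : ℕ) : (Rect p q).Finite := by
  rw [Rect_eq_image]
  exact (Finset.finite_toSet _).image _

lemma cellPoly_Rect (p q : ℕ) :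
    cellPoly (Rect p q) =
      (∑ i ∈ Finset.range q, varX ^ i) * ∑ j ∈ Finset.range p, varY ^ j := by
  rw [Rect_eq_image, cellPoly_image, Finset.sum_mul_sum, Finset.sum_product]
  · simp_rw [varX_pow_mul_varY_pow]
  · rintro ⟨a, b⟩ _ ⟨c, d⟩ _ h
    simpa using h

lemma finite_of_mem_TileSet {n : ℕ} (hn : 1 ≤ n) : ∀ T ∈ TileSet n, T.Finite := by
  rintro T (rfl | rfl | rfl | rfl)
  · exact (finite_vertical _ n hn).union (Set.finite_singleton _)
  · exact (Set.finite_singleton _).union (finite_vertical _ n hn)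
  · exact (finite_horizontal _ n hn).union (Set.finite_singleton _)
  · exact (finite_horizontal _ n hn).union (Set.finite_singleton _)

lemma one_add_dvd_geom_sum_even {A : Type*} [CommRing A] (x : A) (k : ℕ) :
    1 + x ∣ ∑ i ∈ Finset.range (2 * k), x ^ i := by
  induction k with
  | zero => simp
  | succ k ih =>
    rw [mul_add, mul_one, Finset.sum_range_succ, Finset.sum_range_succ, add_assoc]
    exact dvd_add ih ⟨x ^ (2 * k), by ring⟩

lemma geom_sum_dvd_geom_sum {A : Type*} [CommRing A] (x : A) {n m : ℕ} (h : n ∣ m) :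
    ∑ i ∈ Finset.range n, x ^ i ∣ ∑ i ∈ Finset.range m, x ^ i := by
  obtain ⟨d, rfl⟩ := h
  induction d with
  | zero => simp
  | succ d ih =>
    rw [mul_add, mul_one, Finset.sum_range_add]
    refine dvd_add ih ⟨x ^ (n * d), ?_⟩
    simp_rw [pow_add, ← Finset.mul_sum, mul_comm]

/-- The tile relations force both geometric sums of length `2 * k + 1` to vanish. -/
lemma geom_sum_eq_zero_of_tile_relations {A : Type*} [CommRing A] {x y : A} {k : ℕ} (hk : 1 ≤ k)
    (hy : IsUnit y)
    (h1 : ∑ j ∈ Finset.range (2 * k), y ^ j + x = 0)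
    (h2 : y ^ (2 * k - 1) + x * ∑ j ∈ Finset.range (2 * k), y ^ j = 0)
    (h3 : ∑ i ∈ Finset.range (2 * k), x ^ i + y = 0)
    (h4 : y * ∑ i ∈ Finset.range (2 * k), x ^ i + x ^ (2 * k - 1) = 0) :
    ∑ i ∈ Finset.range (2 * k + 1), x ^ i = 0 ∧ ∑ j ∈ Finset.range (2 * k + 1), y ^ j = 0 := by
  have hgx := mul_geom_sum x (2 * k)
  have hgy := mul_geom_sum y (2 * k)
  have hpx : x ^ (2 * k) = x * x ^ (2 * k - 1) := by rw [← pow_succ']; congr 1; omega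
  have hpy : y ^ (2 * k) = y * y ^ (2 * k - 1) := by rw [← pow_succ']; congr 1; omega
  obtain ⟨d, hd⟩ := one_add_dvd_geom_sum_even x k
  rw [Finset.sum_range_succ, Finset.sum_range_succ, hpx, hpy]
  rw [hpx] at hgx
  rw [hpy] at hgy
  generalize x ^ (2 * k - 1) = u at *
  generalize y ^ (2 * k - 1) = v at *
  generalize ∑ i ∈ Finset.range (2 * k), x ^ i = a at *
  generalize ∑ j ∈ Finset.range (2 * k), y ^ j = b at *
  obtain rfl : a = -y := by linear_combination h3
  obtain rfl : b = -x := by linear_combination h1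
  obtain rfl : u = y ^ 2 := by linear_combination h4
  obtain rfl : v = x ^ 2 := by linear_combination h2
  have hxy : x * y = 1 := by
    have h : y * (x * y - 1) = 0 := by linear_combination -(x * y - 1) * hd + d * hgy
    exact sub_eq_zero.1 ((hy.mul_right_eq_zero).1 h)
  constructor
  · linear_combination y * hxy
  · linear_combination x * hxy

/-- The weight `ζ ^ (i - j)` on cells, as an algebra homomorphism on polynomials. -/
noncomputable def diagonalEval (ζ : ℂ) (hζ : ζ ≠ 0) : AddMonoidAlgebra ℤ (ℤ × ℤ) →ₐ[ℤ] ℂ :=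
  AddMonoidAlgebra.lift ℤ ℂ (ℤ × ℤ)
    { toFun := fun c => ζ ^ (c.toAdd.1 - c.toAdd.2)
      map_one' := by simp
      map_mul' := fun c d => by
        rw [← zpow_add₀ hζ]
        congr 1
        simp
        ring }

lemma diagonalEval_varX (ζ : ℂ) (hζ : ζ ≠ 0) : diagonalEval ζ hζ varX = ζ := by
  simp [diagonalEval, varX]

lemma diagonalEval_varY (ζ : ℂ) (hζ : ζ ≠ 0) : diagonalEval ζ hζ varY = ζ⁻¹ := by
  simp [diagonalEval, varY]

lemma dvd_of_geom_sum_eq_zero {ζ : ℂ} {n m : ℕ} (hζ : IsPrimitiveRoot ζ n)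
    (h : ∑ i ∈ Finset.range m, ζ ^ i = 0) : n ∣ m := by
  apply hζ.dvd_of_pow_eq_one
  have := mul_geom_sum ζ m
  rw [h, mul_zero] at this
  linear_combination -this

lemma diagonalEval_eq_zero_of_mem_TileSet {ζ : ℂ} {n : ℕ} (hn : 2 ≤ n)
    (hζ : IsPrimitiveRoot ζ n) {T : Set (ℤ × ℤ)} (hT : T ∈ TileSet n) :
    diagonalEval ζ (hζ.ne_zero (by omega)) (cellPoly T) = 0 := by
  have h0 : ζ ≠ 0 := hζ.ne_zero (by omega)
  obtain ⟨m, rfl⟩ : ∃ m, n = m + 2 := ⟨n - 2, by omega⟩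
  have hgeom : ∀ z : ℂ, IsPrimitiveRoot z (m + 2) →
      ∑ i ∈ Finset.range (m + 1), z ^ i = -z⁻¹ ∧ z ^ m = z⁻¹ ^ 2 := by
    intro z hz
    have hz0 : z ≠ 0 := hz.ne_zero (by omega)
    have h := hz.geom_sum_eq_zero (by omega)
    have h1 := hz.pow_eq_one
    rw [Finset.sum_range_succ] at h
    have hm : z ^ (m + 1) = z⁻¹ := by
      rw [← mul_eq_one_iff_eq_inv₀ hz0, ← pow_succ, h1]
    refine ⟨by linear_combination h - hm, ?_⟩
    rw [inv_pow, ← mul_eq_one_iff_eq_inv₀ (pow_ne_zero _ hz0), ← pow_add, h1]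
  obtain ⟨hx, hx'⟩ := hgeom ζ hζ
  obtain ⟨hy, hy'⟩ := hgeom ζ⁻¹ hζ.inv
  rw [inv_inv] at hy hy'
  rcases hT with rfl | rfl | rfl | rfl
  · simp [cellPoly_T1, diagonalEval_varX, diagonalEval_varY, hy, -inv_pow]
  · rw [cellPoly_T2 _ hn]
    simp only [map_add, map_mul, map_sum, map_pow, diagonalEval_varX, diagonalEval_varY,
      Nat.add_sub_cancel, Nat.reduceSubDiff, hy, hy']
    ring
  · rw [cellPoly_T3 _ (by omega)]
    simp [diagonalEval_varX, diagonalEval_varY, hx]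
  · rw [cellPoly_T4 _ hn]
    simp only [map_add, map_mul, map_sum, map_pow, diagonalEval_varX, diagonalEval_varY,
      Nat.add_sub_cancel, Nat.reduceSubDiff, hx, hx']
    ring

lemma isUnit_varY : IsUnit varY :=
  IsUnit.of_mul_eq_one (single (0, -1) 1) (by
    simp only [varY, single_mul_single, one_def]
    rfl)

lemma geom_sum_mem_span_TileSet {k : ℕ} (hk : 1 ≤ k) :
    ∑ i ∈ Finset.range (2 * k + 1), varX ^ i ∈ Ideal.span (cellPoly '' TileSet (2 * k + 1)) ∧
    ∑ j ∈ Finset.range (2 * k + 1), varY ^ j ∈ Ideal.span (cellPoly '' TileSet (2 * k + 1)) := by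
  set I := Ideal.span (cellPoly '' TileSet (2 * k + 1))
  have hmem : ∀ T ∈ TileSet (2 * k + 1), Ideal.Quotient.mk I (cellPoly T) = 0 := fun T hT =>
    Ideal.Quotient.eq_zero_iff_mem.2 (Ideal.subset_span ⟨T, hT, rfl⟩)
  have h1 := hmem (T1 (2 * k + 1)) (by simp [TileSet])
  have h2 := hmem (T2 (2 * k + 1)) (by simp [TileSet])
  have h3 := hmem (T3 (2 * k + 1)) (by simp [TileSet])
  have h4 := hmem (T4 (2 * k + 1)) (by simp [TileSet])
  rw [cellPoly_T1 _ (by omega)] at h1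
  rw [cellPoly_T2 _ (by omega)] at h2
  rw [cellPoly_T3 _ (by omega)] at h3
  rw [cellPoly_T4 _ (by omega)] at h4
  simp only [← Ideal.Quotient.eq_zero_iff_mem]
  simp only [map_add, map_mul, map_sum, map_pow, Nat.add_sub_cancel] at h1 h2 h3 h4 ⊢
  exact geom_sum_eq_zero_of_tile_relations hk (isUnit_varY.map (Ideal.Quotient.mk I)) h1 h2 h3 h4

/-- For every integer `n = 2k+1` with `k ≥ 2` and all positive integers `p, q`, the
`p × q` rectangle admits a signed tiling by `T_n` iff `n ∣ p` or `n ∣ q`. -/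
theorem rect_signed_tiling_iff_side_div (k : ℕ) (hk : 2 ≤ k) (p q : ℕ)
    (hp : 0 < p) (hq : 0 < q) :
    (∃ w, IsSignedTiling (TileSet (2 * k + 1)) (Rect p q) w) ↔
      (2 * k + 1) ∣ p ∨ (2 * k + 1) ∣ q := by
  rw [exists_isSignedTiling_iff_cellPoly_mem_span (finite_of_mem_TileSet (by omega))
    (finite_Rect p q), cellPoly_Rect]
  constructor
  · intro h
    have hζ := Complex.isPrimitiveRoot_exp (2 * k + 1) (by omega)
    generalize Complex.exp _ = ζ at hζ
    have h0 : ζ ≠ 0 := hζ.ne_zero (by omega)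
    have hker : Ideal.span (cellPoly '' TileSet (2 * k + 1)) ≤
        RingHom.ker (diagonalEval ζ h0) := by
      rw [Ideal.span_le]
      rintro _ ⟨T, hT, rfl⟩
      exact diagonalEval_eq_zero_of_mem_TileSet (by omega) hζ hT
    have h := hker h
    rw [RingHom.mem_ker] at h
    simp only [map_mul, map_sum, map_pow, diagonalEval_varX, diagonalEval_varY] at h
    rcases mul_eq_zero.1 h with h | h
    · exact Or.inr (dvd_of_geom_sum_eq_zero hζ h)
    · exact Or.inl (dvd_of_geom_sum_eq_zero hζ.inv h)
  · obtain ⟨hX, hY⟩ := geom_sum_mem_span_TileSet (k := k) (by omega)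
    rintro (h | h)
    · exact Ideal.mul_mem_left _ _ (Ideal.mem_of_dvd _ (geom_sum_dvd_geom_sum varY h) hY)
    · exact Ideal.mul_mem_right _ _ (Ideal.mem_of_dvd _ (geom_sum_dvd_geom_sum varX h) hX)
end

section
/- For every integer n = 2k+1 with k ≥ 2 and all positive integers p, q such that n does not divide p and n does not divide q, the p×q rectangle admits no (regular) tiling by T_n. -/
open scoped BigOperators Classical

/-- The sum of `ζ ^ m` over `n` consecutive integers vanishes for a primitive `n`-th root `ζ`. -/
theorem sum_zpow_Ico_eq_zero {n : ℕ} (hn : 1 < n) {ζ : ℂ} (hζ : IsPrimitiveRoot ζ n) (a b : ℤ) :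
    ∑ᶠ m ∈ Set.Ico a (a + n), ζ ^ (b + m) = 0 := by
  have hζ0 : ζ ≠ 0 := hζ.ne_zero (by omega)
  have hIco : Set.Ico a (a + n) = (fun j : ℕ => a + j) '' (Finset.range n : Set ℕ) := by
    ext m
    simp only [Set.mem_Ico, Set.mem_image, Finset.coe_range, Set.mem_Iio]
    constructor
    · rintro ⟨h₁, h₂⟩
      exact ⟨(m - a).toNat, by omega, by omega⟩
    · rintro ⟨j, hj, rfl⟩
      omega
  have hinj : Function.Injective fun j : ℕ => a + (j : ℤ) := fun i j h => by simpa using h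
  rw [hIco, finsum_mem_image hinj.injOn, finsum_mem_coe_finset]
  simp only [← add_assoc, zpow_add₀ hζ0 _ (_ : ℤ), zpow_natCast]
  rw [← Finset.mul_sum, hζ.geom_sum_eq_zero hn, mul_zero]

/-- The cells of a ribbon L `n`-omino have `n` consecutive contents `i - j`. -/
theorem exists_bijOn_content_of_mem_TileSet {n : ℕ} (hn : 2 ≤ n) {T : Set (ℤ × ℤ)}
    (hT : T ∈ TileSet n) :
    ∃ a : ℤ, Set.BijOn (fun c : ℤ × ℤ => c.1 - c.2) T (Set.Ico a (a + n)) := by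
  simp only [TileSet, Set.mem_insert_iff, Set.mem_singleton_iff] at hT
  rcases hT with rfl | rfl | rfl | rfl
  · refine ⟨2 - n, ?_, ?_, ?_⟩
    · rintro ⟨i, j⟩ h
      simp only [T1, Set.mem_union, Set.mem_ofPred_eq, Set.mem_singleton_iff, Prod.mk.injEq,
        Set.mem_Ico] at h ⊢
      omega
    · rintro ⟨i, j⟩ h ⟨i', j'⟩ h' e
      simp only [T1, Set.mem_union, Set.mem_ofPred_eq, Set.mem_singleton_iff,
        Prod.mk.injEq] at h h' e ⊢
      omega
    · rintro m hm
      rw [Set.mem_Ico] at hm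
      rcases eq_or_ne m 1 with rfl | h
      · exact ⟨(1, 0), Or.inr rfl, by simp⟩
      · exact ⟨(0, -m), Or.inl ⟨rfl, by dsimp; omega, by dsimp; omega⟩, by simp⟩
  · refine ⟨2 - n, ?_, ?_, ?_⟩
    · rintro ⟨i, j⟩ h
      simp only [T2, Set.mem_union, Set.mem_ofPred_eq, Set.mem_singleton_iff, Prod.mk.injEq,
        Set.mem_Ico] at h ⊢
      omega
    · rintro ⟨i, j⟩ h ⟨i', j'⟩ h' e
      simp only [T2, Set.mem_union, Set.mem_ofPred_eq, Set.mem_singleton_iff,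
        Prod.mk.injEq] at h h' e ⊢
      omega
    · rintro m hm
      rw [Set.mem_Ico] at hm
      rcases eq_or_ne m (2 - n) with rfl | h
      · exact ⟨(0, n - 2), Or.inl rfl, by simp⟩
      · exact ⟨(1, 1 - m), Or.inr ⟨rfl, by dsimp; omega, by dsimp; omega⟩, by simp⟩
  · refine ⟨-1, ?_, ?_, ?_⟩
    · rintro ⟨i, j⟩ h
      simp only [T3, Set.mem_union, Set.mem_ofPred_eq, Set.mem_singleton_iff, Prod.mk.injEq,
        Set.mem_Ico] at h ⊢
      omega
    · rintro ⟨i, j⟩ h ⟨i', j'⟩ h' e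
      simp only [T3, Set.mem_union, Set.mem_ofPred_eq, Set.mem_singleton_iff,
        Prod.mk.injEq] at h h' e ⊢
      omega
    · rintro m hm
      rw [Set.mem_Ico] at hm
      rcases eq_or_ne m (-1) with rfl | h
      · exact ⟨(0, 1), Or.inr rfl, by simp⟩
      · exact ⟨(m, 0), Or.inl ⟨rfl, by dsimp; omega, by dsimp; omega⟩, by simp⟩
  · refine ⟨-1, ?_, ?_, ?_⟩
    · rintro ⟨i, j⟩ h
      simp only [T4, Set.mem_union, Set.mem_ofPred_eq, Set.mem_singleton_iff, Prod.mk.injEq,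
        Set.mem_Ico] at h ⊢
      omega
    · rintro ⟨i, j⟩ h ⟨i', j'⟩ h' e
      simp only [T4, Set.mem_union, Set.mem_ofPred_eq, Set.mem_singleton_iff,
        Prod.mk.injEq] at h h' e ⊢
      omega
    · rintro m hm
      rw [Set.mem_Ico] at hm
      rcases eq_or_ne m (n - 2) with rfl | h
      · exact ⟨(n - 2, 0), Or.inr rfl, by simp⟩
      · exact ⟨(m + 1, 1), Or.inl ⟨rfl, by dsimp; omega, by dsimp; omega⟩, by simp⟩

/-- Weighting the cell `(i, j)` by `ζ ^ (i - j)`, every placed tile has total weight `0`. -/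
theorem sum_content_tileTranslate {n : ℕ} (hn : 2 ≤ n) {ζ : ℂ} (hζ : IsPrimitiveRoot ζ n)
    {T : Set (ℤ × ℤ)} (hT : T ∈ TileSet n) (v : ℤ × ℤ) :
    ∑ᶠ c ∈ tileTranslate v T, ζ ^ (c.1 - c.2) = 0 := by
  obtain ⟨a, ha⟩ := exists_bijOn_content_of_mem_TileSet hn hT
  rw [tileTranslate, finsum_mem_image (add_right_injective v).injOn,
    ← sum_zpow_Ico_eq_zero hn hζ a (v.1 - v.2)]
  refine finsum_mem_eq_of_bijOn _ ha fun c _ => ?_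
  congr 1
  simp only [Prod.fst_add, Prod.snd_add]
  ring

/-- The total weight of a rectangle is a product of two geometric sums. -/
theorem sum_content_Rect {ζ : ℂ} (hζ : ζ ≠ 0) (p q : ℕ) :
    ∑ᶠ c ∈ Rect p q, ζ ^ (c.1 - c.2) =
      (∑ i ∈ Finset.range q, ζ ^ i) * ∑ j ∈ Finset.range p, ζ⁻¹ ^ j := by
  have hR : Rect p q = Prod.map (Nat.cast : ℕ → ℤ) (Nat.cast : ℕ → ℤ) ''
      (Finset.range q ×ˢ Finset.range p : Finset (ℕ × ℕ)) := by
    ext ⟨i, j⟩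
    simp only [Rect, Set.mem_ofPred_eq, Set.mem_image, Finset.mem_coe, Finset.mem_product,
      Finset.mem_range, Prod.exists, Prod.map_apply, Prod.mk.injEq]
    constructor
    · rintro ⟨h₁, h₂, h₃, h₄⟩
      exact ⟨i.toNat, j.toNat, by omega, by omega, by omega⟩
    · rintro ⟨a, b, h, rfl, rfl⟩
      omega
  rw [hR, finsum_mem_image (Nat.cast_injective.prodMap Nat.cast_injective).injOn,
    finsum_mem_coe_finset, Finset.sum_mul_sum, Finset.sum_product]
  refine Finset.sum_congr rfl fun i _ => Finset.sum_congr rfl fun j _ => ?_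
  simp [zpow_sub₀ hζ, div_eq_mul_inv]

theorem geom_sum_ne_zero_of_not_dvd {n : ℕ} {ζ : ℂ} (hζ : IsPrimitiveRoot ζ n) {m : ℕ}
    (hm : ¬ n ∣ m) : ∑ i ∈ Finset.range m, ζ ^ i ≠ 0 := fun h => by
  have := geom_sum_mul ζ m
  rw [h, zero_mul, eq_comm, sub_eq_zero] at this
  exact hm (hζ.dvd_of_pow_eq_one m this)

/-- For every integer `n = 2k+1` with `k ≥ 2` and all positive integers `p, q` with
`n ∤ p` and `n ∤ q`, the `p × q` rectangle admits no regular tiling by `T_n`. -/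
theorem rect_no_tiling_of_not_div (k : ℕ) (hk : 2 ≤ k) (p q : ℕ)
    (hp : 0 < p) (hq : 0 < q) (hnp : ¬ (2 * k + 1) ∣ p) (hnq : ¬ (2 * k + 1) ∣ q) :
    ¬ ∃ P, IsTiling (TileSet (2 * k + 1)) (Rect p q) P := by
  rintro ⟨P, hmem, hdisj, hunion⟩
  have hn : 2 ≤ 2 * k + 1 := by omega
  have hζ := Complex.isPrimitiveRoot_exp (2 * k + 1) (by omega)
  set ζ := Complex.exp (2 * Real.pi * Complex.I / (2 * k + 1 : ℕ))
  have hζ0 : ζ ≠ 0 := hζ.ne_zero (by omega)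
  have hfin : ∀ x ∈ (P : Set (Set (ℤ × ℤ) × (ℤ × ℤ))), (tileTranslate x.2 x.1).Finite := by
    intro x hx
    obtain ⟨a, ha⟩ := exists_bijOn_content_of_mem_TileSet hn (hmem x hx)
    exact (ha.finite_iff_finite.2 (Set.finite_Ico _ _)).image _
  have hsum : ∑ᶠ c ∈ Rect p q, ζ ^ (c.1 - c.2) = 0 := by
    rw [← hunion]
    refine (finsum_mem_biUnion (fun x hx y hy hxy => hdisj x hx y hy hxy)
      P.finite_toSet hfin).trans ?_
    exact finsum_mem_eq_zero_of_forall_eq_zero fun x hx =>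
      sum_content_tileTranslate hn hζ (hmem x hx) x.2
  rw [sum_content_Rect hζ0] at hsum
  exact (mul_ne_zero (geom_sum_ne_zero_of_not_dvd hζ hnq)
    (geom_sum_ne_zero_of_not_dvd hζ.inv hnp)) hsum
end

section
/- For every integer n = 2k+1 with k ≥ 2 and all positive integers p, q that are both odd, the p×q rectangle admits no (regular) tiling by T_n. -/
open scoped BigOperators Classical

/-- `S` is the ribbon tile meeting each diagonal `y - x = e` with `d ≤ e < d + n` in the single
cell of abscissa `X e`; each step goes up or left, and exactly one of the two extreme steps
goes left. -/
def IsRibbon (n d : ℤ) (X : ℤ → ℤ) (S : Set (ℤ × ℤ)) : Prop :=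
  (∀ x e : ℤ, (x, x + e) ∈ S ↔ d ≤ e ∧ e < d + n ∧ X e = x) ∧
  (∀ e, d ≤ e → e + 1 < d + n → X (e + 1) = X e ∨ X (e + 1) = X e - 1) ∧
  X (d + 1) - X d + (X (d + n - 1) - X (d + n - 2)) = -1

theorem IsRibbon.translate {n d : ℤ} {X : ℤ → ℤ} {S : Set (ℤ × ℤ)} (h : IsRibbon n d X S)
    (v : ℤ × ℤ) :
    IsRibbon n (d + (v.2 - v.1)) (fun e => v.1 + X (e - (v.2 - v.1))) (tileTranslate v S) := by
  obtain ⟨hmem, hstep, hends⟩ := h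
  refine ⟨fun x e => ?_, fun e h1 h2 => ?_, ?_⟩
  · have key : (x, x + e) ∈ tileTranslate v S ↔
        (x - v.1, (x - v.1) + (e - (v.2 - v.1))) ∈ S := by
      constructor
      · rintro ⟨c, hc, hcv⟩
        have h1 := congrArg Prod.fst hcv
        have h2 := congrArg Prod.snd hcv
        simp only [Prod.fst_add, Prod.snd_add] at h1 h2
        convert hc using 1
        ext <;> simp only <;> omega
      · intro hc
        refine ⟨_, hc, ?_⟩
        ext <;> simp only [Prod.fst_add, Prod.snd_add] <;> omega
    rw [key, hmem]
    simp only
    constructor <;> rintro ⟨h1, h2, h3⟩ <;> refine ⟨?_, ?_, ?_⟩ <;> omega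
  · have := hstep (e - (v.2 - v.1)) (by omega) (by omega)
    rw [show e - (v.2 - v.1) + 1 = e + 1 - (v.2 - v.1) by ring] at this
    simp only
    omega
  · simp only
    rw [show d + (v.2 - v.1) + 1 - (v.2 - v.1) = d + 1 by ring,
      show d + (v.2 - v.1) - (v.2 - v.1) = d by ring,
      show d + (v.2 - v.1) + n - 1 - (v.2 - v.1) = d + n - 1 by ring,
      show d + (v.2 - v.1) + n - 2 - (v.2 - v.1) = d + n - 2 by ring]
    omega

theorem exists_isRibbon_of_mem_tileSet {n : ℕ} (hn : 3 ≤ n) {T : Set (ℤ × ℤ)}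
    (hT : T ∈ TileSet n) : ∃ d X, IsRibbon n d X T := by
  rcases hT with rfl | rfl | rfl | rfl
  · refine ⟨-1, fun e => if e = -1 then 1 else 0, fun x e => ?_, fun e h1 h2 => ?_, ?_⟩
    · simp only [T1, Set.mem_union, Set.mem_ofPred_eq, Set.mem_singleton_iff, Prod.mk.injEq]
      split_ifs <;> omega
    · simp only
      split_ifs <;> omega
    · simp only
      split_ifs <;> omega
  · refine ⟨-1, fun e => if e = n - 2 then 0 else 1, fun x e => ?_, fun e h1 h2 => ?_, ?_⟩
    · simp only [T2, Set.mem_union, Set.mem_ofPred_eq, Set.mem_singleton_iff, Prod.mk.injEq]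
      split_ifs <;> omega
    · simp only
      split_ifs <;> omega
    · simp only
      split_ifs <;> omega
  · refine ⟨2 - n, fun e => if e = 1 then 0 else -e, fun x e => ?_, fun e h1 h2 => ?_, ?_⟩
    · simp only [T3, Set.mem_union, Set.mem_ofPred_eq, Set.mem_singleton_iff, Prod.mk.injEq]
      split_ifs <;> omega
    · simp only
      split_ifs <;> omega
    · simp only
      split_ifs <;> omega
  · refine ⟨2 - n, fun e => if e = 2 - n then n - 2 else 1 - e, fun x e => ?_,
      fun e h1 h2 => ?_, ?_⟩
    · simp only [T4, Set.mem_union, Set.mem_ofPred_eq, Set.mem_singleton_iff, Prod.mk.injEq]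
      split_ifs <;> omega
    · simp only
      split_ifs <;> omega
    · simp only
      split_ifs <;> omega

theorem sum_sign_sub_Icc {a b y : ℤ} (ha : a ≤ y) (hb : y ≤ b) :
    ∑ x ∈ Finset.Icc a b, (y - x).sign = 2 * y - a - b := by
  have hsign : ∀ x : ℤ, (y - x).sign = (if x < y then 1 else 0) - (if y < x then 1 else 0) := by
    intro x
    rcases lt_trichotomy x y with h | rfl | h
    · rw [Int.sign_eq_one_of_pos (by omega), if_pos h, if_neg (by omega)]; rfl
    · simp
    · rw [Int.sign_eq_neg_one_of_neg (by omega), if_neg (by omega), if_pos h]; rfl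
  have hl : (Finset.Icc a b).filter (fun x => x < y) = Finset.Ico a y := by
    ext x; simp only [Finset.mem_filter, Finset.mem_Icc, Finset.mem_Ico]; omega
  have hr : (Finset.Icc a b).filter (fun x => y < x) = Finset.Ioc y b := by
    ext x; simp only [Finset.mem_filter, Finset.mem_Icc, Finset.mem_Ioc]; omega
  simp only [hsign, Finset.sum_sub_distrib]
  rw [← Finset.sum_filter, ← Finset.sum_filter, hl, hr]
  simp only [Finset.sum_const, Int.card_Ico, Int.card_Ioc, nsmul_eq_mul, mul_one]
  omega

theorem sum_sum_eq_zero_of_antisymm {ι : Type*} (P : Finset ι) (f : ι → ι → ℤ)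
    (hf : ∀ t s, f t s = -f s t) : ∑ t ∈ P, ∑ s ∈ P, f t s = 0 := by
  have h : ∑ t ∈ P, ∑ s ∈ P, f t s = -∑ t ∈ P, ∑ s ∈ P, f t s := by
    conv_lhs => rw [Finset.sum_comm]
    simp only [← Finset.sum_neg_distrib, ← hf]
  omega

/-- The order in which two ribbons meet a common diagonal does not depend on the diagonal. -/
theorem sign_sub_eq_of_disjoint {n d₁ d₂ : ℤ} {X₁ X₂ : ℤ → ℤ} {S₁ S₂ : Set (ℤ × ℤ)}
    (h₁ : IsRibbon n d₁ X₁ S₁) (h₂ : IsRibbon n d₂ X₂ S₂)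
    (hne : ∀ e, d₁ ≤ e → e < d₁ + n → d₂ ≤ e → e < d₂ + n → X₁ e ≠ X₂ e) {e : ℤ}
    (he : max d₁ d₂ ≤ e) :
    e < d₁ + n → e < d₂ + n →
      (X₁ e - X₂ e).sign = (X₁ (max d₁ d₂) - X₂ (max d₁ d₂)).sign := by
  induction e, he using Int.leInduction with
  | base => intros; rfl
  | succ e he ih =>
    intro h3 h4
    rw [← ih (by omega) (by omega)]
    have hs₁ := h₁.2.1 e (by omega) (by omega)
    have hs₂ := h₂.2.1 e (by omega) (by omega)
    have hn := hne e (by omega) (by omega) (by omega) (by omega)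
    have hn' := hne (e + 1) (by omega) (by omega) (by omega) (by omega)
    rcases lt_or_gt_of_ne hn with h | h
    · rw [Int.sign_eq_neg_one_of_neg (by omega), Int.sign_eq_neg_one_of_neg (by omega)]
    · rw [Int.sign_eq_one_of_pos (by omega), Int.sign_eq_one_of_pos (by omega)]

/-- A tiling of the `p × q` rectangle by ribbons `S t`, `t ∈ P`, of length `n`. -/
structure IsRibbonTiling {ι : Type*} (n : ℤ) (p q : ℕ) (P : Finset ι) (d : ι → ℤ)
    (X : ι → ℤ → ℤ) (S : ι → Set (ℤ × ℤ)) : Prop where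
  ribbon : ∀ t ∈ P, IsRibbon n (d t) (X t) (S t)
  mem_rect : ∀ c, c ∈ Rect p q ↔ ∃ t ∈ P, c ∈ S t
  eq_of_mem : ∀ t ∈ P, ∀ s ∈ P, ∀ c, c ∈ S t → c ∈ S s → t = s

namespace IsRibbonTiling

variable {ι : Type*} {n : ℤ} {p q : ℕ} {P : Finset ι} {d : ι → ℤ} {X : ι → ℤ → ℤ}
  {S : ι → Set (ℤ × ℤ)}

theorem eq_of_apply_eq (h : IsRibbonTiling n p q P d X S) {t s : ι} (ht : t ∈ P) (hs : s ∈ P)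
    {e : ℤ} (ht1 : d t ≤ e) (ht2 : e < d t + n) (hs1 : d s ≤ e) (hs2 : e < d s + n)
    (he : X t e = X s e) : t = s :=
  h.eq_of_mem t ht s hs (X t e, X t e + e) (((h.ribbon t ht).1 _ _).2 ⟨ht1, ht2, rfl⟩)
    (((h.ribbon s hs).1 _ _).2 ⟨hs1, hs2, he.symm⟩)

theorem exists_iff (h : IsRibbonTiling n p q P d X S) (x e : ℤ) :
    (∃ t ∈ P, d t ≤ e ∧ e < d t + n ∧ X t e = x) ↔
      max 0 (-e) ≤ x ∧ x ≤ min (q - 1 : ℤ) (p - 1 - e) := by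
  have h1 := h.mem_rect (x, x + e)
  have h2 : (∃ t ∈ P, (x, x + e) ∈ S t) ↔ ∃ t ∈ P, d t ≤ e ∧ e < d t + n ∧ X t e = x :=
    exists_congr fun t => and_congr_right fun ht => (h.ribbon t ht).1 x e
  rw [← h2, ← h1]
  simp only [Rect, Set.mem_ofPred_eq]
  omega

theorem sum_diagonal (h : IsRibbonTiling n p q P d X S) (e : ℤ) (f : ℤ → ℤ) :
    ∑ s ∈ P, (if d s ≤ e ∧ e < d s + n then f (X s e) else 0) =
      ∑ x ∈ Finset.Icc (max 0 (-e)) (min (q - 1 : ℤ) (p - 1 - e)), f x := by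
  rw [← Finset.sum_filter]
  have himg : (P.filter fun s => d s ≤ e ∧ e < d s + n).image (fun s => X s e) =
      Finset.Icc (max 0 (-e)) (min (q - 1 : ℤ) (p - 1 - e)) := by
    ext x
    rw [Finset.mem_Icc, ← h.exists_iff x e]
    simp only [Finset.mem_image, Finset.mem_filter, and_assoc]
  rw [← himg, Finset.sum_image]
  intro t ht s hs hts
  simp only [Finset.coe_filter, Set.mem_ofPred_eq] at ht hs
  exact h.eq_of_apply_eq ht.1 hs.1 ht.2.1 ht.2.2 hs.2.1 hs.2.2 hts

/-- The number of ribbons starting on a diagonal is invariant under the half-turn of the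
rectangle. -/
theorem card_start_symm (h : IsRibbonTiling n p q P d X S) (hn : 0 < n) (e : ℤ) :
    (P.filter fun t => d t = e).card =
      (P.filter fun t => (p - q : ℤ) - d t - n + 1 = e).card := by
  let a : ℤ → ℤ := fun e => ∑ t ∈ P, if d t = e then 1 else 0
  let b : ℤ → ℤ := fun e => ∑ t ∈ P, if (p - q : ℤ) - d t - n + 1 = e then 1 else 0
  let len : ℤ → ℤ := fun e => ∑ t ∈ P, if d t ≤ e ∧ e < d t + n then 1 else 0
  have hlen : ∀ e, len e = len (p - q - e) := by
    intro e
    simp only [len]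
    rw [h.sum_diagonal e (fun _ => 1), h.sum_diagonal (p - q - e) (fun _ => 1)]
    simp only [Finset.sum_const, Int.card_Icc, nsmul_eq_mul, mul_one]
    omega
  have ha : ∀ e, a e - a (e - n) = len e - len (e - 1) := by
    intro e
    simp only [a, len, ← Finset.sum_sub_distrib]
    refine Finset.sum_congr rfl fun t _ => ?_
    split_ifs <;> omega
  have hb : ∀ e, b e - b (e - n) = len (p - q - e) - len (p - q - (e - 1)) := by
    intro e
    simp only [b, len, ← Finset.sum_sub_distrib]
    refine Finset.sum_congr rfl fun t _ => ?_
    split_ifs <;> omega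
  have hper : ∀ e, a e - b e = a (e - n) - b (e - n) := by
    intro e
    have := ha e
    have := hb e
    have := hlen e
    have := hlen (e - 1)
    omega
  have hiter : ∀ (m : ℕ) e, a e - b e = a (e - m * n) - b (e - m * n) := by
    intro m
    induction m with
    | zero => intro e; simp
    | succ m ih =>
      intro e
      rw [ih e, hper]
      push_cast
      rw [show e - m * n - n = e - (m + 1) * n by ring]
  obtain ⟨M, hM⟩ : ∃ M : ℤ, ∀ t ∈ P, M < d t ∧ M < (p - q : ℤ) - d t - n + 1 := by
    obtain ⟨M, hM⟩ := (P.image fun t => min (d t) ((p - q : ℤ) - d t - n + 1)).bddBelow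
    refine ⟨M - 1, fun t ht => ?_⟩
    have := hM (Finset.mem_coe.2 (Finset.mem_image_of_mem _ ht))
    simp only [le_min_iff] at this
    omega
  have hab : a e = b e := by
    have hle : e - (e - M).toNat * n ≤ M := by
      have h1 : e - M ≤ (e - M).toNat := Int.self_le_toNat _
      have h2 : ((e - M).toNat : ℤ) * 1 ≤ (e - M).toNat * n :=
        mul_le_mul_of_nonneg_left (by omega) (by positivity)
      omega
    have h0 := hiter (e - M).toNat e
    have ha0 : a (e - (e - M).toNat * n) = 0 :=
      Finset.sum_eq_zero fun t ht => if_neg (by have := hM t ht; omega)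
    have hb0 : b (e - (e - M).toNat * n) = 0 :=
      Finset.sum_eq_zero fun t ht => if_neg (by have := hM t ht; omega)
    omega
  simp only [a, b, Finset.sum_boole] at hab
  exact_mod_cast hab

theorem sum_start_symm (h : IsRibbonTiling n p q P d X S) (hn : 0 < n) (f : ℤ → ℤ) :
    ∑ t ∈ P, f (d t) = ∑ t ∈ P, f ((p - q : ℤ) - d t - n + 1) := by
  have hms : P.val.map d = P.val.map fun t => (p - q : ℤ) - d t - n + 1 := by
    ext e
    have := h.card_start_symm hn e
    simp only [Multiset.count_map, Finset.card_def, Finset.filter_val] at this ⊢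
    simpa only [eq_comm] using this
  have := congrArg (fun m => (m.map f).sum) hms
  simpa only [Multiset.map_map, Function.comp_def, ← Finset.sum_eq_multiset_sum] using this

theorem even_card (h : IsRibbonTiling n p q P d X S) (hn : 2 ≤ n) : Even P.card := by
  let σ : ι → ι → ℤ := fun t s => (X t (max (d t) (d s)) - X s (max (d t) (d s))).sign
  let center : ℤ → ℤ := fun e => max 0 (-e) + min (q - 1 : ℤ) (p - 1 - e)
  have hσ : ∀ t ∈ P, ∀ e, d t ≤ e → e < d t + n →
      ∑ s ∈ P, (if d s ≤ e ∧ e < d s + n then σ t s else 0) = 2 * X t e - center e := by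
    intro t ht e h1 h2
    have hmem := (h.exists_iff (X t e) e).1 ⟨t, ht, h1, h2, rfl⟩
    have hsum := h.sum_diagonal e fun x => (X t e - x).sign
    rw [sum_sign_sub_Icc hmem.1 hmem.2] at hsum
    rw [show 2 * X t e - center e =
      2 * X t e - max 0 (-e) - min (q - 1 : ℤ) (p - 1 - e) by simp only [center]; ring, ← hsum]
    refine Finset.sum_congr rfl fun s hs => ?_
    split_ifs with hse
    · by_cases hts : t = s
      · subst hts; simp [σ]
      · refine (sign_sub_eq_of_disjoint (h.ribbon t ht) (h.ribbon s hs) ?_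
          (max_le h1 hse.1) h2 hse.2).symm
        intro e' h3 h4 h5 h6 heq
        exact hts (h.eq_of_apply_eq ht hs h3 h4 h5 h6 heq)
    · rfl
  let w : ℤ → ℤ → ℤ := fun a b =>
    (if b = a + 1 then 1 else 0) + (if a = b + 1 then 1 else 0)
      - (if b = a + n - 1 then 1 else 0) - (if a = b + n - 1 then 1 else 0)
  let G : ℤ → ℤ := fun e =>
    (center (e + 1) - center e) - (center (e + n - 1) - center (e + n - 2))
  have hturn : ∀ t ∈ P, ∑ s ∈ P, w (d t) (d s) * σ t s =
      2 * ((X t (d t + 1) - X t (d t)) - (X t (d t + n - 1) - X t (d t + n - 2))) - G (d t) := by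
    intro t ht
    have e1 := hσ t ht (d t + 1) (by omega) (by omega)
    have e2 := hσ t ht (d t) (by omega) (by omega)
    have e3 := hσ t ht (d t + n - 1) (by omega) (by omega)
    have e4 := hσ t ht (d t + n - 2) (by omega) (by omega)
    have : ∑ s ∈ P, w (d t) (d s) * σ t s =
        (2 * X t (d t + 1) - center (d t + 1)) - (2 * X t (d t) - center (d t))
        - ((2 * X t (d t + n - 1) - center (d t + n - 1))
          - (2 * X t (d t + n - 2) - center (d t + n - 2))) := by
      rw [← e1, ← e2, ← e3, ← e4]
      simp only [← Finset.sum_sub_distrib]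
      refine Finset.sum_congr rfl fun s _ => ?_
      have hw : w (d t) (d s) =
          ((if d s ≤ d t + 1 ∧ d t + 1 < d s + n then 1 else 0)
            - (if d s ≤ d t ∧ d t < d s + n then 1 else 0))
          - ((if d s ≤ d t + n - 1 ∧ d t + n - 1 < d s + n then 1 else 0)
            - (if d s ≤ d t + n - 2 ∧ d t + n - 2 < d s + n then 1 else 0)) := by
        simp only [w]
        split_ifs <;> omega
      rw [hw]
      simp only [sub_mul, ite_mul, one_mul, zero_mul]
    rw [this]
    simp only [G]
    ring
  have hzero : ∑ t ∈ P, ∑ s ∈ P, w (d t) (d s) * σ t s = 0 := by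
    refine sum_sum_eq_zero_of_antisymm P _ fun t s => ?_
    have h1 : σ t s = -σ s t := by
      simp only [σ]
      rw [← Int.sign_neg, neg_sub, max_comm]
    have h2 : w (d t) (d s) = w (d s) (d t) := by simp only [w]; ring
    rw [h1, h2, mul_neg]
  have hG : ∑ t ∈ P, G (d t) = 0 := by
    have h1 := h.sum_start_symm (by omega) G
    have h2 : ∀ e, G ((p - q : ℤ) - e - n + 1) = -G e := by
      intro e
      have hc : ∀ e, center (p - q - e) = 2 * q - 2 - center e := by
        intro e
        simp only [center]
        omega
      simp only [G]
      rw [show (p - q : ℤ) - e - n + 1 + 1 = p - q - (e + n - 2) by ring,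
        show (p - q : ℤ) - e - n + 1 = p - q - (e + n - 1) by ring,
        show (p - q : ℤ) - (e + n - 1) + n - 1 = p - q - e by ring,
        show (p - q : ℤ) - (e + n - 1) + n - 2 = p - q - (e + 1) by ring, hc, hc, hc, hc]
      ring
    simp only [h2, Finset.sum_neg_distrib] at h1
    omega
  rw [Finset.sum_congr rfl hturn, Finset.sum_sub_distrib, hG, ← Finset.mul_sum] at hzero
  have hodd : ∀ t ∈ P, ((X t (d t + 1) - X t (d t))
      - (X t (d t + n - 1) - X t (d t + n - 2)) : ZMod 2) = 1 := by
    intro t ht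
    have h1 := congrArg (Int.cast : ℤ → ZMod 2) (h.ribbon t ht).2.2
    push_cast at h1
    rw [CharTwo.sub_eq_add, h1]
    rfl
  have h2 : ∑ t ∈ P, ((X t (d t + 1) - X t (d t)) - (X t (d t + n - 1) - X t (d t + n - 2))) = 0 :=
    by omega
  have h3 := congrArg (Int.cast : ℤ → ZMod 2) h2
  push_cast at h3
  rw [Finset.sum_congr rfl hodd] at h3
  simpa [ZMod.natCast_eq_zero_iff_even] using h3

theorem card_mul (h : IsRibbonTiling n p q P d X S) (hn : 0 ≤ n) :
    (P.card : ℤ) * n = p * q := by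
  have hcard : (P ×ˢ Finset.Ico 0 n).card =
      (Finset.Icc (0 : ℤ) (q - 1) ×ˢ Finset.Icc (0 : ℤ) (p - 1)).card := by
    refine Finset.card_bij
      (fun u _ => (X u.1 (d u.1 + u.2), X u.1 (d u.1 + u.2) + (d u.1 + u.2))) ?_ ?_ ?_
    · rintro ⟨t, j⟩ hu
      simp only [Finset.mem_product, Finset.mem_Ico, Finset.mem_Icc] at hu ⊢
      have := (h.exists_iff _ (d t + j)).1 ⟨t, hu.1, by omega, by omega, rfl⟩
      omega
    · rintro ⟨t, j⟩ hu ⟨s, i⟩ hv heq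
      simp only [Finset.mem_product, Finset.mem_Ico, Prod.mk.injEq] at hu hv heq
      have he : d s + i = d t + j := by omega
      rw [he] at heq
      have hts := h.eq_of_apply_eq hu.1 hv.1 (e := d t + j) (by omega) (by omega) (by omega)
        (by omega) heq.1
      subst hts
      simp only [Prod.mk.injEq, true_and]
      omega
    · rintro ⟨x, y⟩ hc
      simp only [Finset.mem_product, Finset.mem_Icc] at hc
      obtain ⟨t, ht, h1, h2, h3⟩ := (h.exists_iff x (y - x)).2 (by omega)
      refine ⟨(t, y - x - d t), ?_, ?_⟩
      · simp only [Finset.mem_product, Finset.mem_Ico]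
        exact ⟨ht, by omega, by omega⟩
      · simp only [add_sub_cancel, h3]
  simp only [Finset.card_product, Int.card_Ico, Int.card_Icc] at hcard
  have h1 : ((n - 0).toNat : ℤ) = n := by omega
  have h2 : ((q - 1 + 1 - 0 : ℤ).toNat : ℤ) = q := by omega
  have h3 : ((p - 1 + 1 - 0 : ℤ).toNat : ℤ) = p := by omega
  have h4 := congrArg (Nat.cast : ℕ → ℤ) hcard
  simp only [Nat.cast_mul, h1, h2, h3] at h4
  rw [h4, mul_comm]

end IsRibbonTiling

/-- For every integer `n = 2k+1` with `k ≥ 2` and all positive odd integers `p, q`,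
the `p × q` rectangle admits no regular tiling by `T_n`. -/
theorem rect_no_tiling_of_odd_odd (k : ℕ) (hk : 2 ≤ k) (p q : ℕ)
    (hp : 0 < p) (hq : 0 < q) (hop : Odd p) (hoq : Odd q) :
    ¬ ∃ P, IsTiling (TileSet (2 * k + 1)) (Rect p q) P := by
  rintro ⟨P, htiles, hdisj, hcover⟩
  have hrib : ∀ t ∈ P, ∃ d X, IsRibbon (2 * k + 1 : ℕ) d X (tileTranslate t.2 t.1) := by
    intro t ht
    obtain ⟨d, X, h⟩ := exists_isRibbon_of_mem_tileSet (by omega) (htiles t ht)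
    exact ⟨_, _, h.translate t.2⟩
  choose! d X hX using hrib
  have h : IsRibbonTiling (2 * k + 1 : ℕ) p q P d X fun t => tileTranslate t.2 t.1 := by
    refine ⟨hX, fun c => ?_, fun t ht s hs c hct hcs => ?_⟩
    · rw [← hcover]
      simp only [Set.mem_iUnion, exists_prop]
    · by_contra hts
      exact Set.disjoint_left.1 (hdisj t ht s hs hts) hct hcs
  have hmul : P.card * (2 * k + 1) = p * q := by
    exact_mod_cast h.card_mul (by omega)
  have heven : Even (p * q) := hmul ▸ (h.even_card (by omega)).mul_right _
  exact Nat.not_even_iff_odd.2 (hop.mul hoq) heven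
end

section
/- For every integer n = 2k+1 with k ≥ 2 and all positive integers p, q such that either (n divides p and q is even) or (n divides q and p is even), the p×q rectangle admits a (regular) tiling by T_n. -/
open scoped BigOperators Classical

lemma mem_tileTranslate {v c : ℤ × ℤ} {T : Set (ℤ × ℤ)} :
    c ∈ tileTranslate v T ↔ c - v ∈ T := by
  constructor
  · rintro ⟨d, hd, rfl⟩
    simpa using hd
  · intro h
    exact ⟨c - v, h, by simp⟩

/-- Tilings of pairwise disjoint regions combine to a tiling of their union. -/
lemma exists_isTiling_biUnion {ι : Type*} {tiles : Set (Set (ℤ × ℤ))} (s : Finset ι)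
    (R : ι → Set (ℤ × ℤ)) (hR : ∀ i ∈ s, ∀ j ∈ s, i ≠ j → Disjoint (R i) (R j))
    (h : ∀ i, ∃ P, IsTiling tiles (R i) P) :
    ∃ P, IsTiling tiles (⋃ i ∈ s, R i) P := by
  choose P htiles hdisj hcover using h
  have hsub : ∀ i, ∀ x ∈ P i, tileTranslate x.2 x.1 ⊆ R i := fun i x hx => by
    rw [← hcover i]
    exact Set.subset_biUnion_of_mem (u := fun x : Set (ℤ × ℤ) × (ℤ × ℤ) =>
      tileTranslate x.2 x.1) hx
  refine ⟨s.biUnion P, ?_, ?_, ?_⟩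
  · intro x hx
    obtain ⟨i, -, hxi⟩ := Finset.mem_biUnion.1 hx
    exact htiles i x hxi
  · intro x hx y hy hxy
    obtain ⟨i, hi, hxi⟩ := Finset.mem_biUnion.1 hx
    obtain ⟨j, hj, hyj⟩ := Finset.mem_biUnion.1 hy
    by_cases hij : i = j
    · subst hij
      exact hdisj i x hxi y hyj hxy
    · exact (hR i hi j hj hij).mono (hsub i x hxi) (hsub j y hyj)
  · rw [Finset.set_biUnion_biUnion]
    simp only [hcover]

lemma exists_isTiling_pair {tiles : Set (Set (ℤ × ℤ))} {A B R : Set (ℤ × ℤ)} {v w : ℤ × ℤ}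
    (hA : A ∈ tiles) (hB : B ∈ tiles)
    (hdisj : Disjoint (tileTranslate v A) (tileTranslate w B))
    (hcover : tileTranslate v A ∪ tileTranslate w B = R) :
    ∃ P, IsTiling tiles R P := by
  refine ⟨{(A, v), (B, w)}, ?_, ?_, ?_⟩
  · simp [hA, hB]
  · intro x hx y hy hxy
    simp only [Finset.mem_insert, Finset.mem_singleton] at hx hy
    rcases hx with rfl | rfl <;> rcases hy with rfl | rfl
    · exact absurd rfl hxy
    · exact hdisj
    · exact hdisj.symm
    · exact absurd rfl hxy
  · simpa [Finset.set_biUnion_insert] using hcover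

/-- A rectangle whose translates can all be tiled gives tilings of its grid multiples. -/
lemma exists_isTiling_rect_mul {tiles : Set (Set (ℤ × ℤ))} {m l : ℕ} (hm : 0 < m) (hl : 0 < l)
    (h : ∀ v, ∃ P, IsTiling tiles (tileTranslate v (Rect m l)) P) (a b : ℕ) :
    ∃ P, IsTiling tiles (Rect (m * a) (l * b)) P := by
  have hm' : (0 : ℤ) < m := by exact_mod_cast hm
  have hl' : (0 : ℤ) < l := by exact_mod_cast hl
  have hmem : ∀ (i j : ℕ) (c : ℤ × ℤ),
      c ∈ tileTranslate ((l : ℤ) * i, (m : ℤ) * j) (Rect m l) ↔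
        c.1 / l = i ∧ c.2 / m = j := by
    rintro i j ⟨x, y⟩
    simp only [mem_tileTranslate, Rect, Set.mem_ofPred_eq, Prod.fst_sub, Prod.snd_sub,
      Int.ediv_eq_iff_of_pos hl', Int.ediv_eq_iff_of_pos hm']
    constructor
    · rintro ⟨h1, h2, h3, h4⟩
      refine ⟨⟨?_, ?_⟩, ?_, ?_⟩ <;> linarith
    · rintro ⟨⟨h1, h2⟩, h3, h4⟩
      have h2' : x < l * i + l := by linarith
      have h4' : y < m * j + m := by linarith
      refine ⟨by linarith, by omega, by linarith, by omega⟩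
  have hcover : Rect (m * a) (l * b) = ⋃ i ∈ Finset.range b ×ˢ Finset.range a,
      tileTranslate ((l : ℤ) * i.1, (m : ℤ) * i.2) (Rect m l) := by
    ext ⟨x, y⟩
    simp only [Set.mem_iUnion, hmem, Finset.mem_product, Finset.mem_range, exists_prop, Prod.exists]
    simp only [Rect, Set.mem_ofPred_eq, Nat.cast_mul, Int.le_sub_one_iff]
    constructor
    · rintro ⟨hx, hx', hy, hy'⟩
      have h1 := Int.ediv_nonneg hx hl'.le
      have h2 := Int.ediv_nonneg hy hm'.le
      have h3 : x / l < b := Int.ediv_lt_of_lt_mul hl' (by linarith)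
      have h4 : y / m < a := Int.ediv_lt_of_lt_mul hm' (by linarith)
      exact ⟨(x / l).toNat, (y / m).toNat, by omega, by omega, by omega⟩
    · rintro ⟨i, j, ⟨hi, hj⟩, hxi, hyj⟩
      have h1 : x / l < b := by omega
      have h2 : y / m < a := by omega
      rw [Int.ediv_lt_iff_lt_mul hl'] at h1
      rw [Int.ediv_lt_iff_lt_mul hm'] at h2
      exact ⟨(Int.ediv_nonneg_iff_of_pos hl').1 (by omega), by linarith,
        (Int.ediv_nonneg_iff_of_pos hm').1 (by omega), by linarith⟩
  rw [hcover]
  refine exists_isTiling_biUnion _ _ ?_ fun i => h _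
  intro i _ j _ hij
  refine Set.disjoint_left.2 fun c hci hcj => hij ?_
  rw [hmem] at hci hcj
  ext <;> omega

lemma exists_isTiling_translate_rect_two_right {n : ℕ} (hn : 2 ≤ n) (v : ℤ × ℤ) :
    ∃ P, IsTiling (TileSet n) (tileTranslate v (Rect n 2)) P := by
  refine exists_isTiling_pair (A := T1 n) (B := T2 n) (v := v) (w := v + (0, 1))
    (by simp [TileSet]) (by simp [TileSet]) ?_ ?_
  · refine Set.disjoint_left.2 fun c => ?_
    simp only [mem_tileTranslate, T1, T2, Set.mem_union, Set.mem_ofPred_eq, Set.mem_singleton_iff,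
      Prod.ext_iff, Prod.fst_sub, Prod.snd_sub, Prod.fst_add, Prod.snd_add]
    omega
  · ext c
    simp only [mem_tileTranslate, T1, T2, Rect, Set.mem_union, Set.mem_ofPred_eq,
      Set.mem_singleton_iff, Prod.ext_iff, Prod.fst_sub, Prod.snd_sub, Prod.fst_add, Prod.snd_add]
    omega

lemma exists_isTiling_translate_rect_two_left {n : ℕ} (hn : 2 ≤ n) (v : ℤ × ℤ) :
    ∃ P, IsTiling (TileSet n) (tileTranslate v (Rect 2 n)) P := by
  refine exists_isTiling_pair (A := T3 n) (B := T4 n) (v := v) (w := v + (1, 0))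
    (by simp [TileSet]) (by simp [TileSet]) ?_ ?_
  · refine Set.disjoint_left.2 fun c => ?_
    simp only [mem_tileTranslate, T3, T4, Set.mem_union, Set.mem_ofPred_eq, Set.mem_singleton_iff,
      Prod.ext_iff, Prod.fst_sub, Prod.snd_sub, Prod.fst_add, Prod.snd_add]
    omega
  · ext c
    simp only [mem_tileTranslate, T3, T4, Rect, Set.mem_union, Set.mem_ofPred_eq,
      Set.mem_singleton_iff, Prod.ext_iff, Prod.fst_sub, Prod.snd_sub, Prod.fst_add, Prod.snd_add]
    omega

/-- For every integer `n = 2k+1` with `k ≥ 2` and all positive integers `p, q` such that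
either (`n ∣ p` and `q` even) or (`n ∣ q` and `p` even), the `p × q` rectangle admits a
regular tiling by `T_n`. -/
theorem rect_tiling_of_div_and_even (k : ℕ) (hk : 2 ≤ k) (p q : ℕ)
    (hp : 0 < p) (hq : 0 < q)
    (h : ((2 * k + 1) ∣ p ∧ Even q) ∨ ((2 * k + 1) ∣ q ∧ Even p)) :
    ∃ P, IsTiling (TileSet (2 * k + 1)) (Rect p q) P := by
  rcases h with ⟨⟨a, rfl⟩, hq2⟩ | ⟨⟨b, rfl⟩, hp2⟩
  · obtain ⟨b, rfl⟩ := hq2.two_dvd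
    exact exists_isTiling_rect_mul (by omega) two_pos
      (exists_isTiling_translate_rect_two_right (by omega)) a b
  · obtain ⟨a, rfl⟩ := hp2.two_dvd
    exact exists_isTiling_rect_mul two_pos (by omega)
      (exists_isTiling_translate_rect_two_left (by omega)) a b
end

section
/- For every integer n = 2k+1 with k ≥ 2, the 3n×(3n+1) rectangle admits a (regular) tiling by T_n. -/
open scoped BigOperators Classical

lemma mem_tileTranslate_iff (v c : ℤ × ℤ) (T : Set (ℤ × ℤ)) :
    c ∈ tileTranslate v T ↔ (c.1 - v.1, c.2 - v.2) ∈ T := by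
  constructor
  · rintro ⟨d, hd, rfl⟩
    simpa using hd
  · intro h
    exact ⟨_, h, by ext <;> simp⟩

/-- The placement of `T1` (third index `false`) or `T2` (third index `true`) in the block of base `2`
and height `n` whose lower-left corner is `(2a, nb)`; the two together fill the block. -/
def blockPlacement (n : ℕ) (i : ℕ × ℕ × Bool) : Set (ℤ × ℤ) × (ℤ × ℤ) :=
  if i.2.2 then (T2 n, (2 * (i.1 : ℤ), (n : ℤ) * i.2.1 + 1))
  else (T1 n, (2 * (i.1 : ℤ), (n : ℤ) * i.2.1))

lemma mem_blockPlacement_false (n a b : ℕ) (x y : ℤ) :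
    (x, y) ∈ tileTranslate (blockPlacement n (a, b, false)).2 (blockPlacement n (a, b, false)).1 ↔
      (x = 2 * a ∧ n * b ≤ y ∧ y ≤ n * b + n - 2) ∨ (x = 2 * a + 1 ∧ y = n * b) := by
  simp only [mem_tileTranslate_iff, blockPlacement, T1, Bool.false_eq_true, if_false,
    Set.mem_union, Set.mem_ofPred_eq, Set.mem_singleton_iff, Prod.mk.injEq]
  omega

lemma mem_blockPlacement_true (n a b : ℕ) (x y : ℤ) :
    (x, y) ∈ tileTranslate (blockPlacement n (a, b, true)).2 (blockPlacement n (a, b, true)).1 ↔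
      (x = 2 * a ∧ y = n * b + n - 1) ∨
        (x = 2 * a + 1 ∧ n * b + 1 ≤ y ∧ y ≤ n * b + n - 1) := by
  simp only [mem_tileTranslate_iff, blockPlacement, T2, if_true,
    Set.mem_union, Set.mem_ofPred_eq, Set.mem_singleton_iff, Prod.mk.injEq]
  omega

lemma row_band_unique {n b d : ℕ} {y : ℤ} (h₁ : (n : ℤ) * b ≤ y) (h₂ : y ≤ n * b + n - 1)
    (h₃ : (n : ℤ) * d ≤ y) (h₄ : y ≤ n * d + n - 1) : b = d := by
  by_contra hne
  rcases Nat.lt_or_gt_of_ne hne with h | h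
  · have : (n : ℤ) * (b + 1) ≤ n * d := by exact_mod_cast Nat.mul_le_mul_left n h
    linarith
  · have : (n : ℤ) * (d + 1) ≤ n * b := by exact_mod_cast Nat.mul_le_mul_left n h
    linarith

lemma blockPlacement_index_unique {n : ℕ} (hn : 2 ≤ n) {i j : ℕ × ℕ × Bool} {c : ℤ × ℤ}
    (hi : c ∈ tileTranslate (blockPlacement n i).2 (blockPlacement n i).1)
    (hj : c ∈ tileTranslate (blockPlacement n j).2 (blockPlacement n j).1) : i = j := by
  obtain ⟨a, b, s⟩ := i
  obtain ⟨a', b', s'⟩ := j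
  obtain ⟨x, y⟩ := c
  have hb : b = b' := by
    cases s <;> cases s' <;>
      simp only [mem_blockPlacement_false, mem_blockPlacement_true] at hi hj <;>
      exact row_band_unique (n := n) (y := y) (by omega) (by omega) (by omega) (by omega)
  subst hb
  cases s <;> cases s' <;>
    simp only [mem_blockPlacement_false, mem_blockPlacement_true] at hi hj <;>
    simp only [Prod.mk.injEq, reduceCtorEq, and_true, and_false] <;> omega

/-- A rectangle of height `p * n` and even base `2 * q` is tiled by vertical `2 × n` blocks. -/
theorem exists_isTiling_rect_mul_even {n : ℕ} (hn : 2 ≤ n) (p q : ℕ) :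
    ∃ P, IsTiling (TileSet n) (Rect (p * n) (2 * q)) P := by
  refine ⟨(Finset.range q ×ˢ Finset.range p ×ˢ Finset.univ).image (blockPlacement n), ?_, ?_, ?_⟩
  · intro t ht
    obtain ⟨⟨a, b, s⟩, -, rfl⟩ := Finset.mem_image.mp ht
    cases s <;> simp [blockPlacement, TileSet]
  · intro t ht u hu htu
    obtain ⟨i, -, rfl⟩ := Finset.mem_image.mp ht
    obtain ⟨j, -, rfl⟩ := Finset.mem_image.mp hu
    refine Set.disjoint_left.mpr fun c hi hj => htu ?_
    rw [blockPlacement_index_unique hn hi hj]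
  · ext ⟨x, y⟩
    simp only [Set.mem_iUnion, Finset.mem_image, exists_prop, Rect, Set.mem_ofPred_eq]
    constructor
    · rintro ⟨_, ⟨⟨a, b, s⟩, hi, rfl⟩, hc⟩
      simp only [Finset.mem_product, Finset.mem_range, Finset.mem_univ, and_true] at hi
      have hb : (n : ℤ) * b + n ≤ (p * n : ℕ) := by
        have := Nat.mul_le_mul_left n hi.2
        push_cast
        zify at this
        linarith
      have hb₀ : (0 : ℤ) ≤ n * b := by positivity
      cases s <;> simp only [mem_blockPlacement_false, mem_blockPlacement_true] at hc <;> omega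
    · rintro ⟨hx₀, hx, hy₀, hy⟩
      lift x to ℕ using hx₀
      lift y to ℕ using hy₀
      have hyb : y / n < p := Nat.div_lt_of_lt_mul (by rw [Nat.mul_comm]; omega)
      have hdm : (n : ℤ) * (y / n : ℕ) + (y % n : ℕ) = y := by exact_mod_cast Nat.div_add_mod y n
      have hm : y % n < n := Nat.mod_lt _ (by omega)
      have hmem (s : Bool) : (x / 2, y / n, s) ∈
          Finset.range q ×ˢ Finset.range p ×ˢ (Finset.univ : Finset Bool) := by
        simp only [Finset.mem_product, Finset.mem_range, Finset.mem_univ, and_true]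
        exact ⟨by omega, hyb⟩
      by_cases h : (x % 2 = 0 ∧ y % n ≤ n - 2) ∨ (x % 2 = 1 ∧ y % n = 0)
      · refine ⟨_, ⟨(x / 2, y / n, false), hmem _, rfl⟩, ?_⟩
        rw [mem_blockPlacement_false]
        generalize y / n = b at *
        generalize y % n = r at *
        omega
      · refine ⟨_, ⟨(x / 2, y / n, true), hmem _, rfl⟩, ?_⟩
        rw [mem_blockPlacement_true]
        generalize y / n = b at *
        generalize y % n = r at *
        omega

/-- For every integer `n = 2k+1` with `k ≥ 2`, the `3n × (3n+1)` rectangle admits a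
regular tiling by `T_n`. -/
theorem rect_3n_3n1_tiling (k : ℕ) (hk : 2 ≤ k) :
    ∃ P, IsTiling (TileSet (2 * k + 1))
      (Rect (3 * (2 * k + 1)) (3 * (2 * k + 1) + 1)) P := by
  have h : 3 * (2 * k + 1) + 1 = 2 * (3 * k + 2) := by ring
  rw [h]
  exact exists_isTiling_rect_mul_even (by omega) 3 (3 * k + 2)
end

section
/- For every integer n = 2k+1 with k ≥ 2 and every positive integer m, the m-inflated copy of the L n-omino admits a signed tiling by T_n. -/
open scoped BigOperators Classical

/-- The `m`-inflated copy of the L `n`-omino: each cell of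
`L = {(0,j) : 0 ≤ j ≤ n-2} ∪ {(1,0)}` is replaced by an `m × m` block. -/
def InflatedL (n m : ℕ) : Set (ℤ × ℤ) :=
  {c | 0 ≤ c.1 ∧ c.1 ≤ (m : ℤ) - 1 ∧ 0 ≤ c.2 ∧ c.2 ≤ ((n : ℤ) - 1) * m - 1} ∪
  {c | (m : ℤ) ≤ c.1 ∧ c.1 ≤ 2 * (m : ℤ) - 1 ∧ 0 ≤ c.2 ∧ c.2 ≤ (m : ℤ) - 1}

open AddMonoidAlgebra in
/-- The generating function of a finite set of cells, as a Laurent polynomial in two variables. -/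
noncomputable def cellSum (F : Finset (ℤ × ℤ)) : AddMonoidAlgebra ℤ (ℤ × ℤ) :=
  ∑ c ∈ F, single c 1

/-- The rectangle of cells with lower-left corner `(s, t)`, base `a` and height `b`. -/
noncomputable def box (s t a b : ℕ) : Finset (ℤ × ℤ) :=
  Finset.Ico (s : ℤ) (s + a) ×ˢ Finset.Ico (t : ℤ) (t + b)

/-- The Laurent monomial of the cell `(1, 0)`. -/
noncomputable def monX : AddMonoidAlgebra ℤ (ℤ × ℤ) := AddMonoidAlgebra.single (1, 0) 1

/-- The Laurent monomial of the cell `(0, 1)`. -/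
noncomputable def monY : AddMonoidAlgebra ℤ (ℤ × ℤ) := AddMonoidAlgebra.single (0, 1) 1

theorem sum_Ico_eq_sum_range_int {M : Type*} [AddCommMonoid M] (f : ℤ → M) (s : ℤ) (a : ℕ) :
    ∑ i ∈ Finset.Ico s (s + a), f i = ∑ i ∈ Finset.range a, f (s + i) := by
  symm
  refine Finset.sum_bij (fun i _ => s + i) ?_ ?_ ?_ ?_
  · intro i hi
    simp only [Finset.mem_range, Finset.mem_Ico] at *
    omega
  · intro i _ j _ h
    omega
  · intro b hb
    simp only [Finset.mem_range, Finset.mem_Ico] at *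
    exact ⟨(b - s).toNat, by omega, by omega⟩
  · intros
    rfl

theorem monX_pow_mul_monY_pow (i j : ℕ) :
    monX ^ i * monY ^ j = AddMonoidAlgebra.single ((i : ℤ), (j : ℤ)) 1 := by
  simp [monX, monY, AddMonoidAlgebra.single_pow, AddMonoidAlgebra.single_mul_single]

theorem isUnit_monY : IsUnit monY :=
  IsUnit.of_mul_eq_one (AddMonoidAlgebra.single (0, -1) 1) <| by
    simp [monY, AddMonoidAlgebra.single_mul_single, AddMonoidAlgebra.one_def, Prod.mk_zero_zero]

theorem cellSum_box (s t a b : ℕ) :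
    cellSum (box s t a b) = monX ^ s * monY ^ t *
      ((∑ i ∈ Finset.range a, monX ^ i) * ∑ j ∈ Finset.range b, monY ^ j) := by
  rw [cellSum, box, Finset.sum_product, sum_Ico_eq_sum_range_int, Finset.sum_mul_sum,
    Finset.mul_sum]
  refine Finset.sum_congr rfl fun i _ => ?_
  rw [sum_Ico_eq_sum_range_int, Finset.mul_sum]
  refine Finset.sum_congr rfl fun j _ => ?_
  have := monX_pow_mul_monY_pow (s + i) (t + j)
  push_cast at this
  rw [← this]
  ring

theorem coeff_cellSum (F : Finset (ℤ × ℤ)) (c : ℤ × ℤ) :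
    (cellSum F).coeff c = if c ∈ F then 1 else 0 := by
  simp [cellSum, AddMonoidAlgebra.coeff_sum, Finsupp.finsetSum_apply,
    AddMonoidAlgebra.coeff_single, Finsupp.single_apply]

theorem coeff_single_mul_cellSum (v : ℤ × ℤ) (r : ℤ) (F : Finset (ℤ × ℤ)) (c : ℤ × ℤ) :
    (AddMonoidAlgebra.single v r * cellSum F).coeff c =
      if c ∈ tileTranslate v (F : Set (ℤ × ℤ)) then r else 0 := by
  have h := AddMonoidAlgebra.coeff_single_mul_eq_mul_coeff (x := cellSum F) (r := r) (m := v)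
    (m₁ := c) (c - v) (fun m' _ => by rw [eq_sub_iff_add_eq, add_comm])
  rw [h, coeff_cellSum]
  have : c ∈ tileTranslate v (F : Set (ℤ × ℤ)) ↔ c - v ∈ F := by
    simp only [tileTranslate, Set.mem_image, Finset.mem_coe]
    constructor
    · rintro ⟨d, hd, rfl⟩
      simpa using hd
    · exact fun h => ⟨c - v, h, by abel⟩
  simp [this]

/-- The Laurent polynomials whose coefficient function is a combination of translated tiles. -/
def signedTilable (tiles : Set (Set (ℤ × ℤ))) : AddSubgroup (AddMonoidAlgebra ℤ (ℤ × ℤ)) where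
  carrier := {f | ∃ w : Set (ℤ × ℤ) × (ℤ × ℤ) → ℤ, (Function.support w).Finite ∧
    (∀ p, w p ≠ 0 → p.1 ∈ tiles) ∧
    ∀ c : ℤ × ℤ, (∑ᶠ p ∈ {p : Set (ℤ × ℤ) × (ℤ × ℤ) | c ∈ tileTranslate p.2 p.1}, w p) =
      f.coeff c}
  zero_mem' := ⟨0, by simp, by simp, by simp⟩
  add_mem' := by
    rintro f g ⟨w, hw, hwt, hwc⟩ ⟨u, hu, hut, huc⟩
    refine ⟨w + u, (hw.union hu).subset (Function.support_add w u), fun p hp => ?_, fun c => ?_⟩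
    · by_cases h : w p = 0
      · exact hut p fun h' => hp (by simp [h, h'])
      · exact hwt p h
    · rw [AddMonoidAlgebra.coeff_add, Finsupp.add_apply, ← hwc, ← huc]
      exact finsum_mem_add_distrib' (hw.inter_of_right _) (hu.inter_of_right _)
  neg_mem' := by
    rintro f ⟨w, hw, hwt, hwc⟩
    refine ⟨-w, by rwa [Function.support_neg], fun p hp => hwt p (by simpa using hp), fun c => ?_⟩
    rw [AddMonoidAlgebra.coeff_neg, Finsupp.neg_apply, ← hwc]
    simp only [Pi.neg_apply, finsum_neg_distrib]

theorem single_mul_cellSum_mem_signedTilable {tiles : Set (Set (ℤ × ℤ))} {F : Finset (ℤ × ℤ)}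
    (hF : (F : Set (ℤ × ℤ)) ∈ tiles) (v : ℤ × ℤ) (r : ℤ) :
    AddMonoidAlgebra.single v r * cellSum F ∈ signedTilable tiles := by
  refine ⟨Pi.single ((F : Set (ℤ × ℤ)), v) r,
    (Set.finite_singleton _).subset Pi.support_single_subset, fun p hp => ?_, fun c => ?_⟩
  · have : p = ((F : Set (ℤ × ℤ)), v) := by
      by_contra h
      exact hp (Pi.single_eq_of_ne h _)
    rwa [this]
  · rw [coeff_single_mul_cellSum, finsum_mem_def, finsum_eq_single _ ((F : Set (ℤ × ℤ)), v)]
    · simp [Set.indicator_apply]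
    · intro p hp
      simp [Set.indicator_apply, Pi.single_eq_of_ne hp]

theorem mem_signedTilable_of_mem_span {tiles : Set (Set (ℤ × ℤ))}
    {f : AddMonoidAlgebra ℤ (ℤ × ℤ)}
    (hf : f ∈ Ideal.span {g | ∃ F : Finset (ℤ × ℤ), (F : Set (ℤ × ℤ)) ∈ tiles ∧ cellSum F = g}) :
    f ∈ signedTilable tiles := by
  induction hf using Submodule.closure_induction with
  | zero => exact zero_mem _
  | add x y _ _ hx hy => exact add_mem hx hy
  | smul_mem a x hx =>
    obtain ⟨F, hF, rfl⟩ := hx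
    rw [smul_eq_mul]
    induction a using AddMonoidAlgebra.induction_linear with
    | zero => simp [zero_mem]
    | add a b ha hb => rw [add_mul]; exact add_mem ha hb
    | single v r => exact single_mul_cellSum_mem_signedTilable hF v r

theorem geom_sum_mul_exponent {B : Type*} [CommRing B] (a : B) (m r : ℕ) :
    ∑ i ∈ Finset.range (m * r), a ^ i =
      (∑ i ∈ Finset.range m, a ^ i) * ∑ i ∈ Finset.range r, (a ^ m) ^ i := by
  induction r with
  | zero => simp
  | succ r ih =>
    rw [Nat.mul_succ, Finset.sum_range_add, ih, Finset.sum_range_succ, mul_add]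
    congr 1
    simp only [pow_add, pow_mul, ← Finset.mul_sum]
    ring

theorem mul_eq_one_of_ribbon_relations {B : Type*} [CommRing B] {x y : B} (hy : IsUnit y)
    {k : ℕ} (hk : 1 ≤ k)
    (h₁ : ∑ i ∈ Finset.range (2 * k), y ^ i + x = 0)
    (h₂ : y ^ (2 * k - 1) + x * ∑ i ∈ Finset.range (2 * k), y ^ i = 0)
    (h₃ : ∑ i ∈ Finset.range (2 * k), x ^ i + y = 0) : x * y = 1 := by
  have hX : (x + 1) * (x * y - 1) = 0 := by
    have h := geom_sum_mul y (2 * k)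
    have hp : y ^ (2 * k) = y ^ (2 * k - 1) * y := by
      rw [← pow_succ]
      congr 1
      omega
    rw [hp] at h
    linear_combination (y - 1 + x * y) * h₁ - h - y * h₂
  have hfac := geom_sum_mul_exponent x 2 k
  rw [Finset.sum_range_succ, Finset.sum_range_one] at hfac
  have hzero : y * (x * y - 1) = 0 := by
    linear_combination (x * y - 1) * h₃ - (x * y - 1) * hfac -
      (∑ i ∈ Finset.range k, (x ^ 2) ^ i) * hX
  exact sub_eq_zero.1 ((hy.mul_right_eq_zero).1 hzero)

theorem inflated_relation {B : Type*} [CommRing B] {x y : B} (hxy : x * y = 1) {k : ℕ}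
    (h : ∑ i ∈ Finset.range (2 * k), y ^ i + x = 0) (m : ℕ) :
    (∑ i ∈ Finset.range m, x ^ i) * ∑ j ∈ Finset.range (m * (2 * k)), y ^ j +
      x ^ m * ((∑ i ∈ Finset.range m, x ^ i) * ∑ j ∈ Finset.range m, y ^ j) = 0 := by
  have hn : ∑ i ∈ Finset.range (2 * k + 1), y ^ i = 0 := by
    rw [geom_sum_succ]
    linear_combination y * h - hxy
  have hxm : x ^ m * y ^ m = 1 := by rw [← mul_pow, hxy, one_pow]
  have hcol : (∑ j ∈ Finset.range m, y ^ j) * ∑ i ∈ Finset.range (2 * k + 1), (y ^ m) ^ i = 0 := by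
    rw [← geom_sum_mul_exponent, mul_comm, geom_sum_mul_exponent, hn, zero_mul]
  rw [geom_sum_succ] at hcol
  rw [geom_sum_mul_exponent]
  linear_combination (x ^ m * ∑ i ∈ Finset.range m, x ^ i) * hcol -
    ((∑ i ∈ Finset.range m, x ^ i) * (∑ j ∈ Finset.range m, y ^ j) *
      ∑ i ∈ Finset.range (2 * k), (y ^ m) ^ i) * hxm

theorem cellSum_union_box {s t a b s' t' a' b' : ℕ}
    (h : Disjoint (box s t a b) (box s' t' a' b')) :
    cellSum (box s t a b ∪ box s' t' a' b') =
      cellSum (box s t a b) + cellSum (box s' t' a' b') := by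
  unfold cellSum
  convert Finset.sum_union h

theorem mem_box {s t a b : ℕ} {c : ℤ × ℤ} :
    c ∈ box s t a b ↔ ((s : ℤ) ≤ c.1 ∧ c.1 < s + a) ∧ (t : ℤ) ≤ c.2 ∧ c.2 < t + b := by
  simp [box]

theorem T1_eq_coe_box {k : ℕ} :
    T1 (2 * k + 1) = ((box 0 0 1 (2 * k) ∪ box 1 0 1 1 : Finset (ℤ × ℤ)) : Set (ℤ × ℤ)) := by
  ext ⟨i, j⟩
  simp only [T1, Set.mem_union, Set.mem_ofPred_eq, Set.mem_singleton_iff, Prod.mk.injEq,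
    Finset.coe_union, Finset.mem_coe, mem_box]
  push_cast
  omega

theorem T2_eq_coe_box {k : ℕ} (hk : 1 ≤ k) :
    T2 (2 * k + 1) =
      ((box 0 (2 * k - 1) 1 1 ∪ box 1 0 1 (2 * k) : Finset (ℤ × ℤ)) : Set (ℤ × ℤ)) := by
  ext ⟨i, j⟩
  simp only [T2, Set.mem_union, Set.mem_ofPred_eq, Set.mem_singleton_iff, Prod.mk.injEq,
    Finset.coe_union, Finset.mem_coe, mem_box]
  push_cast
  omega

theorem T3_eq_coe_box {k : ℕ} :
    T3 (2 * k + 1) = ((box 0 0 (2 * k) 1 ∪ box 0 1 1 1 : Finset (ℤ × ℤ)) : Set (ℤ × ℤ)) := by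
  ext ⟨i, j⟩
  simp only [T3, Set.mem_union, Set.mem_ofPred_eq, Set.mem_singleton_iff, Prod.mk.injEq,
    Finset.coe_union, Finset.mem_coe, mem_box]
  push_cast
  omega

theorem inflatedL_eq_coe_box (k m : ℕ) :
    InflatedL (2 * k + 1) m =
      ((box 0 0 m (m * (2 * k)) ∪ box m 0 m m : Finset (ℤ × ℤ)) : Set (ℤ × ℤ)) := by
  ext ⟨i, j⟩
  have h : (((2 * k + 1 : ℕ) : ℤ) - 1) * m = ((m * (2 * k) : ℕ) : ℤ) := by
    push_cast
    ring
  simp only [InflatedL, Set.mem_union, Set.mem_ofPred_eq, Finset.coe_union, Finset.mem_coe,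
    mem_box, h]
  omega

theorem cellSum_inflatedL_mem_span {k : ℕ} (hk : 1 ≤ k) (m : ℕ) :
    cellSum (box 0 0 m (m * (2 * k)) ∪ box m 0 m m) ∈
      Ideal.span {g | ∃ F : Finset (ℤ × ℤ),
        (F : Set (ℤ × ℤ)) ∈ TileSet (2 * k + 1) ∧ cellSum F = g} := by
  set I := Ideal.span {g | ∃ F : Finset (ℤ × ℤ),
    (F : Set (ℤ × ℤ)) ∈ TileSet (2 * k + 1) ∧ cellSum F = g}
  have hmem {F : Finset (ℤ × ℤ)} (hF : (F : Set (ℤ × ℤ)) ∈ TileSet (2 * k + 1)) :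
      Ideal.Quotient.mk I (cellSum F) = 0 :=
    Ideal.Quotient.eq_zero_iff_mem.2 (Ideal.subset_span ⟨F, hF, rfl⟩)
  have hdisj {s t a b s' t' a' b' : ℕ} (h : s + a ≤ s' ∨ t + b ≤ t') :
      Disjoint (box s t a b) (box s' t' a' b') := by
    rw [Finset.disjoint_left]
    intro c hc hc'
    rw [mem_box] at hc hc'
    omega
  have h₁ := hmem (F := box 0 0 1 (2 * k) ∪ box 1 0 1 1) (by simp [TileSet, T1_eq_coe_box])
  have h₂ := hmem (F := box 0 (2 * k - 1) 1 1 ∪ box 1 0 1 (2 * k))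
    (by simp [TileSet, T2_eq_coe_box hk])
  have h₃ := hmem (F := box 0 0 (2 * k) 1 ∪ box 0 1 1 1) (by simp [TileSet, T3_eq_coe_box])
  rw [cellSum_union_box (hdisj (by omega)), cellSum_box, cellSum_box] at h₁ h₂ h₃
  simp only [pow_zero, pow_one, one_mul, mul_one, Finset.sum_range_one, map_add, map_mul,
    map_sum, map_pow] at h₁ h₂ h₃
  have hxy := mul_eq_one_of_ribbon_relations (isUnit_monY.map (Ideal.Quotient.mk I)) hk h₁ h₂ h₃
  rw [← Ideal.Quotient.eq_zero_iff_mem, cellSum_union_box (hdisj (by omega)), cellSum_box,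
    cellSum_box]
  simp only [pow_zero, one_mul, mul_one, map_add, map_mul, map_sum, map_pow]
  exact inflated_relation hxy h₁ m

/-- For every integer `n = 2k+1` with `k ≥ 2` and every positive integer `m`, the
`m`-inflated copy of the L `n`-omino admits a signed tiling by `T_n`. -/
theorem inflatedL_signed_tiling (k : ℕ) (hk : 2 ≤ k) (m : ℕ) (hm : 0 < m) :
    ∃ w, IsSignedTiling (TileSet (2 * k + 1)) (InflatedL (2 * k + 1) m) w := by
  obtain ⟨w, hw, hwt, hwc⟩ :=
    mem_signedTilable_of_mem_span (cellSum_inflatedL_mem_span (by omega : 1 ≤ k) m)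
  refine ⟨w, hw, hwt, fun c => ?_⟩
  rw [hwc, coeff_cellSum, inflatedL_eq_coe_box]
  simp only [Finset.mem_coe]
end

section
/- For every integer n = 2k+1 with k ≥ 2 and every positive integer m such that m is odd and n divides m, the m-inflated copy of the L n-omino admits no (regular) tiling by T_n. -/
open scoped BigOperators Classical

/-- The Young diagram with rows of length `f y`, `0 ≤ y`. -/
def youngRegion (f : ℤ → ℤ) : Set (ℤ × ℤ) := {c | 0 ≤ c.2 ∧ 0 ≤ c.1 ∧ c.1 < f c.2}

/-- `f` is the row-length function of a Young diagram with at most `N` rows. -/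
structure IsRowLength (N : ℤ) (f : ℤ → ℤ) : Prop where
  anti : ∀ y z, 0 ≤ y → y ≤ z → f z ≤ f y
  nonneg : ∀ y, 0 ≤ y → 0 ≤ f y
  zero : ∀ y, N ≤ y → f y = 0

/-- Row lengths after removing the rim hook of size `n` in the rows `a, …, a + h`. -/
def removeHook (n : ℤ) (f : ℤ → ℤ) (a h y : ℤ) : ℤ :=
  if a ≤ y ∧ y < a + h then f (y + 1) - 1 else if y = a + h then f a + h - n else f y

/-- The bead positions (beta numbers) of a Young diagram with at most `N` rows. -/
noncomputable def beads (N : ℤ) (f : ℤ → ℤ) : Finset ℤ :=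
  (Finset.Ico 0 N).image fun y => f y - y

/-- The indicator of a pair whose residues modulo `n` are in the opposite order. -/
noncomputable def invPair (n a b : ℤ) : ZMod 2 := if a < b ∧ b % n < a % n then 1 else 0

/-- The parity of the number of residue inversions of a bead set. -/
noncomputable def invParity (n : ℤ) (B : Finset ℤ) : ZMod 2 :=
  ∑ a ∈ B, ∑ b ∈ B, invPair n a b

theorem mem_translate_T1 (n : ℕ) (v : ℤ × ℤ) (x y : ℤ) :
    (x, y) ∈ tileTranslate v (T1 n) ↔
      (x = v.1 ∧ v.2 ≤ y ∧ y ≤ v.2 + n - 2) ∨ (x = v.1 + 1 ∧ y = v.2) := by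
  obtain ⟨a, b⟩ := v
  simp only [tileTranslate, T1, Set.mem_image, Set.mem_union, Set.mem_ofPred_eq,
    Set.mem_singleton_iff, Prod.exists, Prod.mk_add_mk, Prod.mk.injEq]
  constructor
  · rintro ⟨i, j, h, rfl, rfl⟩; omega
  · intro h; exact ⟨x - a, y - b, by omega, by omega, by omega⟩

theorem mem_translate_T2 (n : ℕ) (v : ℤ × ℤ) (x y : ℤ) :
    (x, y) ∈ tileTranslate v (T2 n) ↔
      (x = v.1 ∧ y = v.2 + n - 2) ∨ (x = v.1 + 1 ∧ v.2 ≤ y ∧ y ≤ v.2 + n - 2) := by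
  obtain ⟨a, b⟩ := v
  simp only [tileTranslate, T2, Set.mem_image, Set.mem_union, Set.mem_ofPred_eq,
    Set.mem_singleton_iff, Prod.exists, Prod.mk_add_mk, Prod.mk.injEq]
  constructor
  · rintro ⟨i, j, h, rfl, rfl⟩; omega
  · intro h; exact ⟨x - a, y - b, by omega, by omega, by omega⟩

theorem mem_translate_T3 (n : ℕ) (v : ℤ × ℤ) (x y : ℤ) :
    (x, y) ∈ tileTranslate v (T3 n) ↔
      (y = v.2 ∧ v.1 ≤ x ∧ x ≤ v.1 + n - 2) ∨ (x = v.1 ∧ y = v.2 + 1) := by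
  obtain ⟨a, b⟩ := v
  simp only [tileTranslate, T3, Set.mem_image, Set.mem_union, Set.mem_ofPred_eq,
    Set.mem_singleton_iff, Prod.exists, Prod.mk_add_mk, Prod.mk.injEq]
  constructor
  · rintro ⟨i, j, h, rfl, rfl⟩; omega
  · intro h; exact ⟨x - a, y - b, by omega, by omega, by omega⟩

theorem mem_translate_T4 (n : ℕ) (v : ℤ × ℤ) (x y : ℤ) :
    (x, y) ∈ tileTranslate v (T4 n) ↔
      (y = v.2 + 1 ∧ v.1 ≤ x ∧ x ≤ v.1 + n - 2) ∨ (x = v.1 + n - 2 ∧ y = v.2) := by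
  obtain ⟨a, b⟩ := v
  simp only [tileTranslate, T4, Set.mem_image, Set.mem_union, Set.mem_ofPred_eq,
    Set.mem_singleton_iff, Prod.exists, Prod.mk_add_mk, Prod.mk.injEq]
  constructor
  · rintro ⟨i, j, h, rfl, rfl⟩; omega
  · intro h; exact ⟨x - a, y - b, by omega, by omega, by omega⟩

theorem IsTiling.erase {tiles : Set (Set (ℤ × ℤ))} {R : Set (ℤ × ℤ)}
    {P : Finset (Set (ℤ × ℤ) × (ℤ × ℤ))} (h : IsTiling tiles R P)
    {p : Set (ℤ × ℤ) × (ℤ × ℤ)} (hp : p ∈ P) :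
    IsTiling tiles (R \ tileTranslate p.2 p.1) (P.erase p) := by
  obtain ⟨h1, h2, h3⟩ := h
  refine ⟨fun q hq => h1 q (Finset.mem_of_mem_erase hq), fun q hq r hr =>
    h2 q (Finset.mem_of_mem_erase hq) r (Finset.mem_of_mem_erase hr), ?_⟩
  ext c
  simp only [← h3, Set.mem_iUnion, Set.mem_sdiff, Finset.mem_erase, exists_prop]
  constructor
  · rintro ⟨q, ⟨hqp, hq⟩, hc⟩
    exact ⟨⟨q, hq, hc⟩, fun hc' => Set.disjoint_left.1 (h2 q hq p hp hqp) hc hc'⟩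
  · rintro ⟨⟨q, hq, hc⟩, hc'⟩
    exact ⟨q, ⟨fun e => hc' (e ▸ hc), hq⟩, hc⟩

/-- A cell of maximal level `x - y` among those whose upper neighbour is outside the diagram and
whose left neighbour is not in the same tile. -/
theorem exists_maximal_start {tiles : Set (Set (ℤ × ℤ))} {N : ℤ} {f : ℤ → ℤ}
    (hf : IsRowLength N f) {P : Finset (Set (ℤ × ℤ) × (ℤ × ℤ))}
    (hP : IsTiling tiles (youngRegion f) P) (hne : (youngRegion f).Nonempty) :
    ∃ p ∈ P, ∃ x y : ℤ, (x, y) ∈ tileTranslate p.2 p.1 ∧ (x - 1, y) ∉ tileTranslate p.2 p.1 ∧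
      f (y + 1) ≤ x ∧
      ∀ x' y' : ℤ, (x', y') ∈ youngRegion f → f (y' + 1) ≤ x' → x - y < x' - y' →
        ∀ q ∈ P, (x' - 1, y') ∈ tileTranslate q.2 q.1 → (x', y') ∈ tileTranslate q.2 q.1 := by
  obtain ⟨h1, h2, h3⟩ := hP
  have hcov : ∀ c, c ∈ youngRegion f ↔ ∃ p ∈ P, c ∈ tileTranslate p.2 p.1 := by
    intro c; simp [← h3]
  let S : ℤ → Prop := fun z => ∃ p ∈ P, ∃ x y : ℤ, (x, y) ∈ tileTranslate p.2 p.1 ∧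
    (x - 1, y) ∉ tileTranslate p.2 p.1 ∧ f (y + 1) ≤ x ∧ x - y = z
  have hb : ∃ b, ∀ z, S z → z ≤ b := by
    refine ⟨f 0, ?_⟩
    rintro z ⟨p, hp, x, y, hxy, -, -, rfl⟩
    have := (hcov _).2 ⟨p, hp, hxy⟩
    obtain ⟨hy, hx, hxf⟩ := this
    have := hf.anti 0 y le_rfl hy
    simp only at *
    omega
  have hex : ∃ z, S z := by
    obtain ⟨c, hc⟩ := hne
    obtain ⟨y, ⟨hy0, hy⟩, hmax⟩ := Int.exists_greatest_of_bdd (P := fun y => 0 ≤ y ∧ 0 < f y)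
      ⟨N, fun z hz => by by_contra hlt; have := hf.zero z (by omega); omega⟩
      ⟨c.2, hc.1, lt_of_le_of_lt hc.2.1 hc.2.2⟩
    obtain ⟨p, hp, hm⟩ := (hcov (0, y)).1 ⟨hy0, le_rfl, hy⟩
    refine ⟨_, p, hp, 0, y, hm, fun hm' => ?_, ?_, rfl⟩
    · have := ((hcov _).2 ⟨p, hp, hm'⟩).2.1
      simp at this
    · by_contra hlt
      have := hmax (y + 1) ⟨by omega, by omega⟩
      omega
  obtain ⟨z, ⟨p, hp, x, y, hm, hl, hu, rfl⟩, hmax⟩ := Int.exists_greatest_of_bdd hb hex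
  refine ⟨p, hp, x, y, hm, hl, hu, fun x' y' hr hu' hlt q hq hq' => ?_⟩
  obtain ⟨r, hr, hm'⟩ := (hcov _).1 hr
  by_cases hl' : (x' - 1, y') ∈ tileTranslate r.2 r.1
  · by_cases hqr : q = r
    · exact hqr ▸ hm'
    · exact absurd hl' (Set.disjoint_left.1 (h2 q hq r hr hqr) hq')
  · have := hmax _ ⟨r, hr, x', y', hm', hl', hu', rfl⟩
    omega

theorem exists_removable {k : ℕ} (hk : 2 ≤ k) {N : ℤ} {f : ℤ → ℤ}
    (hf : IsRowLength N f) {P : Finset (Set (ℤ × ℤ) × (ℤ × ℤ))}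
    (hP : IsTiling (TileSet (2 * k + 1)) (youngRegion f) P) (hne : (youngRegion f).Nonempty) :
    ∃ p ∈ P, ∃ a h : ℤ, 0 ≤ a ∧ 0 < h ∧ Odd h ∧ 0 ≤ f a + h - (2 * k + 1) ∧
      f (a + h + 1) ≤ f a + h - (2 * k + 1) ∧ f a + h - (2 * k + 1) < f (a + h) ∧
      ∀ x y, (x, y) ∈ tileTranslate p.2 p.1 ↔
        a ≤ y ∧ y ≤ a + h ∧ removeHook (2 * k + 1) f a h y ≤ x ∧ x < f y := by
  obtain ⟨p, hp, x, y, hm, hl, hu, hmax⟩ := exists_maximal_start hf hP hne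
  have hsub : ∀ x y, (x, y) ∈ tileTranslate p.2 p.1 → 0 ≤ y ∧ 0 ≤ x ∧ x < f y := by
    intro x y hxy
    have : (x, y) ∈ youngRegion f := by
      rw [← hP.2.2]; simp only [Set.mem_iUnion]; exact ⟨p, hp, hxy⟩
    exact this
  have hup : (x, y + 1) ∉ tileTranslate p.2 p.1 := fun h => by
    have := hsub _ _ h; omega
  have key : ∀ x' y', (x', y') ∈ tileTranslate p.2 p.1 → (x' + 1, y') ∉ tileTranslate p.2 p.1 →
      f (y' + 1) ≤ x' + 1 → x - y ≤ x' - y' → f y' = x' + 1 := by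
    intro x' y' h1 h2 h3 h4
    have h5 := hsub _ _ h1
    by_contra hne
    exact h2 (hmax (x' + 1) y' ⟨h5.1, by simp only; omega, by simp only; omega⟩ h3 (by omega) p hp
      (by simpa using h1))
  have hT := hP.1 p hp
  obtain ⟨T, u, w⟩ := p
  simp only at hT hm hl hup key hsub
  refine ⟨_, hp, ?_⟩
  simp only
  have column : ∀ c v : ℤ, (∀ z, v < z → z ≤ y → (c, z) ∈ tileTranslate (u, w) T) →
      (∀ z, v < z → z ≤ y → (c + 1, z) ∉ tileTranslate (u, w) T) → f (y + 1) ≤ c + 1 →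
      x ≤ c → ∀ z, v < z → z ≤ y → f z = c + 1 := by
    intro c v hin hout htop hxc z hz hzy
    induction z, hzy using Int.leInductionDown with
    | base => exact key _ _ (hin _ hz le_rfl) (hout _ hz le_rfl) htop (by omega)
    | pred z hzy ih =>
      refine key _ _ (hin _ hz (by omega)) (hout _ hz (by omega)) ?_ (by omega)
      rw [sub_add_cancel]
      exact (ih (by omega)).le
  rcases hT with rfl | rfl | rfl | rfl
  · simp only [mem_translate_T1] at *
    push_cast at *
    obtain ⟨rfl, hy⟩ : x = u ∧ w + (2 * k - 1) = y := by omega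
    have hcol := column x w (by omega) (by omega) (by omega) le_rfl
    have hw : f w = x + 1 + 1 :=
      key (x + 1) w (by omega) (by omega) (by rw [hcol] <;> omega) (by omega)
    have h0 := hsub x w (by omega)
    refine ⟨w, 2 * k - 1, by omega, by omega, ⟨k - 1, by ring⟩, by omega, ?_, ?_, ?_⟩
    · rw [hy]; omega
    · rw [hy, hcol y] <;> omega
    · intro x' y'
      have h1 := hcol y'
      have h2 := hcol (y' + 1)
      unfold removeHook
      rcases eq_or_ne y' w with rfl | hne' <;> split_ifs <;> omega
  · simp only [mem_translate_T2] at *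
    push_cast at *
    obtain ⟨rfl, hy⟩ : x = u ∧ w + (2 * k - 1) = y := by omega
    have hcol := column (x + 1) (w - 1) (by omega) (by omega) (by omega) (by omega)
    have hw := hcol w (by omega) (by omega)
    have h0 := hsub x y (by omega)
    have h0' := hsub (x + 1) w (by omega)
    refine ⟨w, 2 * k - 1, by omega, by omega, ⟨k - 1, by ring⟩, by omega, ?_, ?_, ?_⟩
    · rw [hy]; omega
    · rw [hy, hcol y] <;> omega
    · intro x' y'
      have h1 := hcol y'
      have h2 := hcol (y' + 1)
      unfold removeHook
      split_ifs <;> omega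
  · simp only [mem_translate_T3] at *
    push_cast at *
    obtain ⟨rfl, rfl⟩ : x = u ∧ y = w + 1 := by omega
    have h1 : f (w + 1) = x + 1 := key x (w + 1) (by omega) (by omega) (by omega) (by omega)
    have h2 : f w = x + 2 * k - 1 + 1 :=
      key (x + 2 * k - 1) w (by omega) (by omega) (by omega) (by omega)
    have h0 := hsub x w (by omega)
    refine ⟨w, 1, by omega, by omega, odd_one, by omega, by omega, by omega, ?_⟩
    intro x' y'
    unfold removeHook
    rcases eq_or_ne y' w with rfl | hne'
    · split_ifs <;> omega
    · rcases eq_or_ne y' (w + 1) with rfl | hne''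
      · split_ifs <;> omega
      · split_ifs <;> omega
  · simp only [mem_translate_T4] at *
    push_cast at *
    obtain ⟨rfl, rfl⟩ : x = u ∧ y = w + 1 := by omega
    have h1 : f (w + 1) = x + 2 * k - 1 + 1 :=
      key (x + 2 * k - 1) (w + 1) (by omega) (by omega) (by omega) (by omega)
    have h2 : f w = x + 2 * k - 1 + 1 :=
      key (x + 2 * k - 1) w (by omega) (by omega) (by omega) (by omega)
    have h0 := hsub x (w + 1) (by omega)
    have h0' := hsub (x + 2 * k - 1) w (by omega)
    refine ⟨w, 1, by omega, by omega, odd_one, by omega, by omega, by omega, ?_⟩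
    intro x' y'
    unfold removeHook
    rcases eq_or_ne y' w with rfl | hne'
    · split_ifs <;> omega
    · rcases eq_or_ne y' (w + 1) with rfl | hne''
      · split_ifs <;> omega
      · split_ifs <;> omega

theorem removeHook_isRowLength {n N : ℤ} {f : ℤ → ℤ} (hf : IsRowLength N f) {a h : ℤ}
    (ha : 0 ≤ a) (hh : 0 < h) (h0 : 0 ≤ f a + h - n)
    (h1 : f (a + h + 1) ≤ f a + h - n) (h2 : f a + h - n < f (a + h)) :
    IsRowLength N (removeHook n f a h) := by
  have hN : a + h < N := by
    by_contra hlt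
    have := hf.zero (a + h) (by omega)
    omega
  have hpos : ∀ y, 0 ≤ y → y ≤ a + h → f (a + h) ≤ f y := fun y => hf.anti y (a + h)
  refine ⟨fun y z hy hyz => ?_, fun y hy => ?_, fun y hy => ?_⟩
  · have e1 := hf.anti y z hy hyz
    have e2 := hf.anti (y + 1) (z + 1) (by omega) (by omega)
    have e3 := hf.anti z (z + 1) (by omega) (by omega)
    have e4 := hpos y hy
    have e5 := hpos (y + 1) (by omega)
    have e6 : a + h + 1 ≤ z → f z ≤ f (a + h + 1) := hf.anti _ _ (by omega)
    have e7 : y + 1 ≤ z → f z ≤ f (y + 1) := hf.anti _ _ (by omega)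
    unfold removeHook
    split_ifs <;> omega
  · have e4 := hpos (y + 1) (by omega)
    have e5 := hf.nonneg y hy
    unfold removeHook
    split_ifs <;> omega
  · have := hf.zero y hy
    unfold removeHook
    split_ifs <;> omega

theorem youngRegion_removeHook {n N : ℤ} {f : ℤ → ℤ} (hf : IsRowLength N f) {a h : ℤ}
    (hh : 0 < h) (h2 : f a + h - n < f (a + h)) {T : Set (ℤ × ℤ)}
    (hT : ∀ x y, (x, y) ∈ T ↔ a ≤ y ∧ y ≤ a + h ∧ removeHook n f a h y ≤ x ∧ x < f y) :
    youngRegion f \ T = youngRegion (removeHook n f a h) := by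
  ext ⟨x, y⟩
  simp only [youngRegion, Set.mem_sdiff, Set.mem_ofPred_eq, hT]
  by_cases hy : 0 ≤ y
  · have e1 := hf.anti y (y + 1) hy (by omega)
    unfold removeHook
    rcases eq_or_ne y (a + h) with rfl | hne
    · split_ifs <;> omega
    · split_ifs <;> omega
  · simp [hy]

theorem sum_beads {M : Type*} [AddCommMonoid M] {N : ℤ} {f : ℤ → ℤ} (hf : IsRowLength N f)
    (g : ℤ → M) : ∑ b ∈ beads N f, g b = ∑ y ∈ Finset.Ico 0 N, g (f y - y) := by
  refine Finset.sum_image fun y hy z hz hyz => ?_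
  simp only [Finset.coe_Ico, Set.mem_Ico] at hy hz
  rcases le_total y z with h | h
  · have := hf.anti y z hy.1 h; omega
  · have := hf.anti z y hz.1 h; omega

theorem invParity_insert (n p : ℤ) {C : Finset ℤ} (hp : p ∉ C) :
    invParity n (insert p C) =
      invParity n C + ∑ c ∈ C, (invPair n p c + invPair n c p) := by
  have h0 : invPair n p p = 0 := by simp [invPair]
  simp only [invParity, Finset.sum_insert hp, h0, Finset.sum_add_distrib]
  ring

theorem invPair_move {n p c : ℤ} (hn : 0 < n) (h1 : c ≠ p) (h2 : c ≠ p - n) :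
    invPair n p c + invPair n c p + (invPair n (p - n) c + invPair n c (p - n)) =
      if p - n < c ∧ c < p then 1 else 0 := by
  have hr : (p - n) % n = p % n := by simp
  have h11 : (1 : ZMod 2) + 1 = 0 := rfl
  have hmod : ¬ (c % n = p % n ∧ p - n < c ∧ c < p) := by
    rintro ⟨h, h3, h4⟩
    have h5 : n ∣ p - c := Int.ModEq.dvd h
    have := Int.le_of_dvd (by omega) h5
    omega
  simp only [invPair, hr]
  generalize c % n = r, p % n = s at hmod
  split_ifs <;> first | (exfalso; omega) | simp [h11]

/-- Removing a rim hook occupying `h + 1` rows changes the inversion parity by `h`. -/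
theorem beads_removeHook {n N : ℤ} {f : ℤ → ℤ} (hf : IsRowLength N f) {a h : ℤ} (hn : 0 < n)
    (ha : 0 ≤ a) (hh : 0 < h) (h0 : 0 ≤ f a + h - n)
    (h1 : f (a + h + 1) ≤ f a + h - n) (h2 : f a + h - n < f (a + h)) :
    (∑ b ∈ beads N f, b = ∑ b ∈ beads N (removeHook n f a h), b + n) ∧
      invParity n (beads N f) = invParity n (beads N (removeHook n f a h)) + (h : ZMod 2) := by
  have hN : a + h < N := by
    by_contra hlt
    have := hf.zero (a + h) (by omega)
    omega
  set p := f a - a with hp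
  set I := (Finset.Ico 0 N).erase a with hI
  set C := I.image fun y => f y - y with hC
  have hanti : ∀ y z, 0 ≤ y → y < z → f z - z < f y - y := fun y z hy hyz => by
    have := hf.anti y z hy hyz.le
    omega
  have hinj : Set.InjOn (fun y => f y - y) (I : Set ℤ) := fun y hy z hz hyz => by
    simp only [hI, Finset.coe_erase, Finset.coe_Ico, Set.mem_sdiff, Set.mem_Ico] at hy hz
    rcases lt_trichotomy y z with hlt | he | hlt
    · have := hanti y z hy.1.1 hlt; simp only at hyz; omega
    · exact he
    · have := hanti z y hz.1.1 hlt; simp only at hyz; omega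
  have hmem : ∀ y ∈ I, 0 ≤ y ∧ y < N ∧ y ≠ a := fun y hy => by
    simp only [hI, Finset.mem_erase, Finset.mem_Ico] at hy; omega
  have hbetween : ∀ y ∈ I, f y - y ≠ p ∧ f y - y ≠ p - n ∧
      ((p - n < f y - y ∧ f y - y < p) ↔ (a < y ∧ y ≤ a + h)) := by
    intro y hy
    obtain ⟨hy0, hyN, hya⟩ := hmem y hy
    have e1 := hanti a y ha
    have e2 := hanti y a hy0
    have e3 := hf.anti y (a + h) hy0
    have e4 := hf.anti (a + h + 1) y (by omega)
    omega
  have hpC : p ∉ C := fun hc => by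
    obtain ⟨y, hy, he⟩ := Finset.mem_image.1 hc
    exact (hbetween y hy).1 he
  have hqC : p - n ∉ C := fun hc => by
    obtain ⟨y, hy, he⟩ := Finset.mem_image.1 hc
    exact (hbetween y hy).2.1 he
  have hB : beads N f = insert p C := by
    rw [beads, ← Finset.insert_erase (show a ∈ Finset.Ico 0 N by simp; omega),
      Finset.image_insert]
  have hB' : beads N (removeHook n f a h) = insert (p - n) C := by
    ext z
    simp only [beads, hC, hI, Finset.mem_insert, Finset.mem_image, Finset.mem_erase,
      Finset.mem_Ico]
    constructor
    · rintro ⟨y, hy, rfl⟩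
      unfold removeHook
      split_ifs with c1 c2
      · exact Or.inr ⟨y + 1, by omega, by omega⟩
      · left; omega
      · exact Or.inr ⟨y, by omega, by omega⟩
    · rintro (rfl | ⟨y, hy, rfl⟩)
      · refine ⟨a + h, by omega, ?_⟩
        rw [removeHook, if_neg (by omega), if_pos rfl]
        omega
      · by_cases c : a < y ∧ y ≤ a + h
        · refine ⟨y - 1, by omega, ?_⟩
          rw [removeHook, if_pos (by omega), sub_add_cancel]
          omega
        · refine ⟨y, by omega, ?_⟩
          rw [removeHook, if_neg (by omega), if_neg (by omega)]
  have hcount : ∑ c ∈ C, (if p - n < c ∧ c < p then (1 : ZMod 2) else 0) = (h : ZMod 2) := by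
    rw [hC, Finset.sum_image hinj, Finset.sum_congr rfl fun y hy =>
      if_congr (hbetween y hy).2.2 rfl rfl, Finset.sum_boole]
    have : I.filter (fun y => a < y ∧ y ≤ a + h) = Finset.Ioc a (a + h) := by
      ext y
      simp only [hI, Finset.mem_filter, Finset.mem_erase, Finset.mem_Ico, Finset.mem_Ioc]
      omega
    rw [this, Int.card_Ioc, ← Int.cast_natCast, Int.toNat_of_nonneg (by omega)]
    congr 1
    ring
  have hmove : ∑ c ∈ C, (invPair n p c + invPair n c p) +
      ∑ c ∈ C, (invPair n (p - n) c + invPair n c (p - n)) = (h : ZMod 2) := by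
    rw [← hcount, ← Finset.sum_add_distrib]
    exact Finset.sum_congr rfl fun c hc => invPair_move hn (fun e => hpC (e ▸ hc))
      (fun e => hqC (e ▸ hc))
  rw [hB, hB']
  refine ⟨?_, ?_⟩
  · rw [Finset.sum_insert hpC, Finset.sum_insert hqC]
    ring
  · rw [invParity_insert n p hpC, invParity_insert n _ hqC, ← hmove, add_assoc]
    congr 1
    rw [add_left_comm, CharTwo.add_self_eq_zero, add_zero]

theorem tiling_parity {k : ℕ} (hk : 2 ≤ k) {N : ℤ} (P : Finset (Set (ℤ × ℤ) × (ℤ × ℤ))) :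
    ∀ f : ℤ → ℤ, IsRowLength N f → IsTiling (TileSet (2 * k + 1)) (youngRegion f) P →
      ∃ t : ℤ, ∑ b ∈ beads N f, b = ∑ b ∈ beads N 0, b + (2 * k + 1) * t ∧
        invParity (2 * k + 1) (beads N f) = invParity (2 * k + 1) (beads N 0) + (t : ZMod 2) := by
  induction P using Finset.strongInduction with
  | H P ih =>
  intro f hf hP
  rcases (youngRegion f).eq_empty_or_nonempty with he | hne
  · have hf0 : beads N f = beads N 0 := Finset.image_congr fun y hy => by
      have hy0 : 0 ≤ y := by simp at hy; omega
      have h1 := hf.nonneg y hy0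
      have h2 : (0, y) ∉ youngRegion f := by simp [he]
      simp only [youngRegion, Set.mem_ofPred_eq] at h2
      simp only [Pi.zero_apply]
      omega
    exact ⟨0, by simp [hf0], by simp [hf0]⟩
  · obtain ⟨p, hp, a, h, ha, hh, hodd, h0, h1, h2, hT⟩ := exists_removable hk hf hP hne
    have hP' := hP.erase hp
    rw [youngRegion_removeHook hf hh h2 hT] at hP'
    obtain ⟨t, ht1, ht2⟩ := ih _ (Finset.erase_ssubset hp) _
      (removeHook_isRowLength hf ha hh h0 h1 h2) hP'
    obtain ⟨e1, e2⟩ := beads_removeHook hf (by omega) ha hh h0 h1 h2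
    have hodd' : (h : ZMod 2) = 1 := by
      obtain ⟨j, rfl⟩ := hodd
      have : (2 : ZMod 2) = 0 := rfl
      simp [this]
    refine ⟨t + 1, ?_, ?_⟩
    · rw [e1, ht1]; ring
    · rw [e2, ht2, hodd']; push_cast; ring

theorem invParity_beads_of_dvd {n N : ℤ} {f g : ℤ → ℤ} (hf : IsRowLength N f)
    (hg : IsRowLength N g) (hfn : ∀ y, n ∣ f y) (hgn : ∀ y, n ∣ g y) :
    invParity n (beads N f) = invParity n (beads N g) := by
  have hmod : ∀ f : ℤ → ℤ, (∀ y, n ∣ f y) → ∀ y, (f y - y) % n = (-y) % n := fun f hfn y => by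
    obtain ⟨c, hc⟩ := hfn y
    rw [hc, sub_eq_add_neg, add_comm, Int.add_mul_emod_self_left]
  have hlt : ∀ f : ℤ → ℤ, IsRowLength N f → ∀ y z, 0 ≤ y → 0 ≤ z →
      (f y - y < f z - z ↔ z < y) := fun f hf y z hy hz => by
    have := hf.anti y z hy
    have := hf.anti z y hz
    omega
  simp only [invParity, sum_beads hf, sum_beads hg, invPair]
  refine Finset.sum_congr rfl fun y hy => Finset.sum_congr rfl fun z hz => ?_
  rw [Finset.mem_Ico] at hy hz
  simp only [hlt f hf y z hy.1 hz.1, hlt g hg y z hy.1 hz.1, hmod f hfn, hmod g hgn]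

/-- Row lengths of the inflated L. -/
noncomputable def inflatedRow (m M y : ℤ) : ℤ := if y < m then 2 * m else if y < M then m else 0

theorem inflatedRow_isRowLength {m M : ℤ} (hm : 0 ≤ m) (hM : m ≤ M) :
    IsRowLength M (inflatedRow m M) := by
  refine ⟨fun y z _ _ => ?_, fun y _ => ?_, fun y _ => ?_⟩ <;> unfold inflatedRow <;>
    split_ifs <;> omega

theorem sum_inflatedRow {m M : ℤ} (hm : 0 ≤ m) (hM : m ≤ M) :
    ∑ y ∈ Finset.Ico 0 M, inflatedRow m M y = m * m + M * m := by
  have h : ∀ y ∈ Finset.Ico 0 M, inflatedRow m M y = (if y < m then m else 0) + m := by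
    intro y hy
    rw [Finset.mem_Ico] at hy
    unfold inflatedRow
    split_ifs <;> omega
  have hfilter : (Finset.Ico 0 M).filter (· < m) = Finset.Ico 0 m := by
    ext y; simp only [Finset.mem_filter, Finset.mem_Ico]; omega
  rw [Finset.sum_congr rfl h, Finset.sum_add_distrib, ← Finset.sum_filter, hfilter]
  simp [hm, hm.trans hM]

theorem youngRegion_inflatedRow {n m : ℕ} (hn : 2 ≤ n) :
    youngRegion (inflatedRow m (((n : ℤ) - 1) * m)) = InflatedL n m := by
  have hM : (m : ℤ) ≤ ((n : ℤ) - 1) * m := le_mul_of_one_le_left (by omega) (by omega)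
  ext ⟨x, y⟩
  simp only [youngRegion, InflatedL, inflatedRow, Set.mem_union, Set.mem_ofPred_eq]
  generalize ((n : ℤ) - 1) * m = M at *
  split_ifs <;> omega

/-- For every integer `n = 2k+1` with `k ≥ 2` and every positive integer `m` which is
odd and divisible by `n`, the `m`-inflated copy of the L `n`-omino admits no regular
tiling by `T_n`. -/
theorem inflatedL_no_tiling_of_odd_div (k : ℕ) (hk : 2 ≤ k) (m : ℕ) (hm : 0 < m)
    (hmo : Odd m) (hmd : (2 * k + 1) ∣ m) :
    ¬ ∃ P, IsTiling (TileSet (2 * k + 1)) (InflatedL (2 * k + 1) m) P := by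
  rintro ⟨P, hP⟩
  have hm0 : (0 : ℤ) ≤ m := by omega
  have hM : (m : ℤ) ≤ ((2 * k + 1 : ℕ) - 1 : ℤ) * m :=
    le_mul_of_one_le_left hm0 (by push_cast; omega)
  have hrow := inflatedRow_isRowLength hm0 hM
  have hzero : IsRowLength (((2 * k + 1 : ℕ) - 1 : ℤ) * m) 0 :=
    ⟨fun _ _ _ _ => le_rfl, fun _ _ => le_rfl, fun _ _ => rfl⟩
  rw [← youngRegion_inflatedRow (by omega)] at hP
  obtain ⟨t, ht1, ht2⟩ := tiling_parity hk P _ hrow hP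
  have hdvd : (2 * k + 1 : ℤ) ∣ m := by exact_mod_cast hmd
  rw [invParity_beads_of_dvd hrow hzero (fun y => ?_) (fun y => dvd_zero _)] at ht2
  · rw [sum_beads hrow, sum_beads hzero, Finset.sum_sub_distrib, Finset.sum_sub_distrib,
      sum_inflatedRow hm0 hM] at ht1
    have ht : t = m * m := by
      have : (2 * k + 1 : ℤ) * t = (2 * k + 1) * (m * m) := by
        simp only [Pi.zero_apply, Finset.sum_const_zero] at ht1
        push_cast at ht1
        linarith
      exact mul_left_cancel₀ (by omega) this
    have hm1 : (m : ZMod 2) = 1 := (ZMod.natCast_eq_one_iff_odd).2 hmo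
    rw [ht] at ht2
    push_cast at ht2
    rw [hm1, left_eq_add] at ht2
    exact absurd ht2 (by decide)
  · unfold inflatedRow
    split_ifs
    · exact hdvd.mul_left 2
    · exact hdvd
    · exact dvd_zero _
end
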